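/- arXiv:2605.19055 — 13 statements merged into one kernel-verified Lean document; each statement's English description precedes it below -/
import Mathlib

section
/- Let P ⊊ Q ⊆ D₁^{r₁} and R ⊊ S ⊆ D₂^{r₂} be predicates over finite domains, let 𝓘 = (I₁, …, I_{r₂}) be a sequence of subsets of [r₁], and suppose P | Q is an 𝓘-substructure of R | S with witnessing maps g₁, …, g_{r₂}. If H = (V₁, …, V_{r₁}, E) is an r₁-partite non-redundant instance of CSP(P | Q), then the projection hypergraph pr_𝓘 H — the r₂-partite hypergraph whose parts are π_{I₁}E, …, π_{I_{r₂}}E and whose edge set is {(π_{I₁}e, …, π_{I_{r₂}}e) : e ∈ E} — is a non-redundant instance of CSP(R | S); moreover the map e ↦ (π_{I₁}e, …, π_{I_{r₂}}e) is injective on E, so pr_𝓘 H has exactly |E| edges. -/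
open Set

/-- `H = (V, E)` (with vertex type `V` and ordered hyperedges `E`) is a (conditionally)
non-redundant instance of `CSP(P | Q)`: for each edge `e` there is an assignment that
`P`-satisfies every other edge but `Q \ P`-satisfies `e`.  For plain non-redundancy
take `Q = Set.univ`. -/
def IsNRDInstance {ι D V : Type*} (P Q : Set (ι → D)) (E : Set (ι → V)) : Prop :=
  ∀ e ∈ E, ∃ ψ : V → D,
    (∀ e' ∈ E, e' ≠ e → (fun i => ψ (e' i)) ∈ P) ∧ (fun i => ψ (e i)) ∈ Q \ P

/-- `NRD(P | Q, n)`: the maximum number of edges of a non-redundant instance of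
`CSP(P | Q)` on `n` vertices. -/
noncomputable def NRD {ι D : Type*} (P Q : Set (ι → D)) (n : ℕ) : ℕ :=
  sSup {m | ∃ E : Set (ι → Fin n), IsNRDInstance P Q E ∧ E.ncard = m}

/-- A partite non-redundant instance of `CSP(P | Q)`: the vertex set is the disjoint
union of the parts `V i`, and each edge selects one vertex from each part. -/
def IsPartiteNRDInstance {ι D : Type*} {V : ι → Type*} (P Q : Set (ι → D))
    (E : Set (∀ i, V i)) : Prop :=
  ∀ e ∈ E, ∃ ψ : ∀ i, V i → D,
    (∀ e' ∈ E, e' ≠ e → (fun i => ψ i (e' i)) ∈ P) ∧ (fun i => ψ i (e i)) ∈ Q \ P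

/-- Projection `π_I` of a tuple onto the coordinates in `I`. -/
def proj {ι : Type*} (I : Set ι) {X : ι → Type*} (e : ∀ i, X i) : ∀ i : I, X i.1 :=
  fun i => e i.1

/-- `P | Q` is an `𝓘`-substructure of `R | S`. -/
def IsSubstructure {ι₁ ι₂ D₁ D₂ : Type*} (P Q : Set (ι₁ → D₁)) (R S : Set (ι₂ → D₂))
    (𝓘 : ι₂ → Set ι₁) : Prop :=
  ∃ g : ∀ j : ι₂, (↥(𝓘 j) → D₁) → D₂,
    (∀ x ∈ P, (fun j => g j (fun i => x i.1)) ∈ R) ∧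
    (∀ x ∈ Q \ P, (fun j => g j (fun i => x i.1)) ∈ S \ R)

/-- The `Q`-part of the box product of conditional predicates. -/
def boxQ {ι₁ ι₂ D : Type*} (Q₁ : Set (ι₁ → D)) (Q₂ : Set (ι₂ → D)) : Set (ι₁ ⊕ ι₂ → D) :=
  {x | (fun i => x (Sum.inl i)) ∈ Q₁ ∧ (fun i => x (Sum.inr i)) ∈ Q₂}

/-- The `P`-part of the box product: `P₃ = (P₁ × Q₂) ∪ (Q₁ × P₂)`. -/
def boxP {ι₁ ι₂ D : Type*} (P₁ Q₁ : Set (ι₁ → D)) (P₂ Q₂ : Set (ι₂ → D)) :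
    Set (ι₁ ⊕ ι₂ → D) :=
  {x | ((fun i => x (Sum.inl i)) ∈ P₁ ∧ (fun i => x (Sum.inr i)) ∈ Q₂) ∨
       ((fun i => x (Sum.inl i)) ∈ Q₁ ∧ (fun i => x (Sum.inr i)) ∈ P₂)}

/-- Lemma (projection hypergraphs preserve non-redundancy).
If `P | Q` is an `𝓘`-substructure of `R | S` with witnessing maps `g`, and
`H = (V₁, …, V_{r₁}, E)` is an `r₁`-partite non-redundant instance of `CSP(P | Q)`,
then the projection hypergraph `pr_𝓘 H`, whose part `j` consists of the projected
tuples `π_{I_j} e` and whose edges are `(π_{I₁} e, …, π_{I_{r₂}} e)` for `e ∈ E`, is a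
non-redundant instance of `CSP(R | S)`; moreover `e ↦ (π_{I₁} e, …, π_{I_{r₂}} e)` is
injective on `E`, so `pr_𝓘 H` has exactly `|E|` edges. -/
theorem projection_NRD
    {D₁ D₂ : Type} [Fintype D₁] [Fintype D₂] {r₁ r₂ : ℕ}
    (P Q : Set (Fin r₁ → D₁)) (R S : Set (Fin r₂ → D₂))
    (hPQ : P ⊂ Q) (hRS : R ⊂ S)
    (𝓘 : Fin r₂ → Set (Fin r₁))
    (g : ∀ j : Fin r₂, (↥(𝓘 j) → D₁) → D₂)
    (hgP : ∀ x ∈ P, (fun j => g j (fun i => x i.1)) ∈ R)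
    (hgQP : ∀ x ∈ Q \ P, (fun j => g j (fun i => x i.1)) ∈ S \ R)
    (V : Fin r₁ → Type) (hVfin : ∀ i, Finite (V i))
    (E : Set (∀ i, V i))
    (hNR : IsPartiteNRDInstance P Q E) :
    IsPartiteNRDInstance R S ((fun e => fun j : Fin r₂ => proj (𝓘 j) e) '' E) ∧
    Set.InjOn (fun e => fun j : Fin r₂ => proj (𝓘 j) e) E ∧
    ((fun e => fun j : Fin r₂ => proj (𝓘 j) e) '' E).ncard = E.ncard := by
  have hinj : Set.InjOn (fun e => fun j : Fin r₂ => proj (𝓘 j) e) E := by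
    intro e he e' he' h
    by_contra hne
    obtain ⟨ψ, h1, h2⟩ := hNR e he
    have hR := hgP _ (h1 e' he' (fun h => hne h.symm))
    have hS := hgQP _ h2
    apply hS.2
    have key : (fun j => g j (fun i : 𝓘 j => ψ i.1 (e i.1)))
        = (fun j => g j (fun i : 𝓘 j => ψ i.1 (e' i.1))) := by
      funext j
      congr 1
      funext i
      have hi : e i.1 = e' i.1 := congrFun (congrFun h j) i
      rw [hi]
    rw [key]
    exact hR
  refine ⟨?_, hinj, Set.ncard_image_of_injOn hinj⟩
  rintro _ ⟨e, he, rfl⟩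
  obtain ⟨ψ, h1, h2⟩ := hNR e he
  refine ⟨fun j v => g j (fun i => ψ i.1 (v i)), ?_, hgQP _ h2⟩
  rintro _ ⟨e', he', rfl⟩ hne
  exact hgP _ (h1 e' he' (fun h => hne (by rw [h])))
end

section
/- Let P ⊊ Q ⊆ D₁^{r₁} and R ⊊ S ⊆ D₂^{r₂} be predicates over finite domains with P and R nonempty, let c ≥ 1 be an integer, and let 𝓘 = (I₁, …, I_{r₂}) be a sequence of subsets of [r₁], each of size at most c, such that P | Q is an 𝓘-substructure of R | S. If there exist a > 0 and α ≥ 1 such that NRD(P | Q, n) ≥ a · n^α for all n ≥ 1, then there exist b > 0 and n₀ such that NRD(R | S, n) ≥ b · n^{α/c} for all n ≥ n₀. -/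
open Set

theorem nrd_bddAbove {r n : ℕ} {D : Type} (P Q : Set (Fin r → D)) :
    BddAbove {m | ∃ E : Set (Fin r → Fin n), IsNRDInstance P Q E ∧ E.ncard = m} := by
  refine ⟨Nat.card (Fin r → Fin n), ?_⟩
  rintro m ⟨E, -, rfl⟩
  exact Set.ncard_le_card E

theorem nrd_exists {r n : ℕ} {D : Type} (P Q : Set (Fin r → D)) :
    ∃ E : Set (Fin r → Fin n), IsNRDInstance P Q E ∧ E.ncard = NRD P Q n := by
  have h := Nat.sSup_mem (s := {m | ∃ E : Set (Fin r → Fin n), IsNRDInstance P Q E ∧ E.ncard = m})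
    ⟨0, ∅, by intro e he; exact absurd he (Set.notMem_empty e), by simp⟩ (nrd_bddAbove P Q)
  exact h

theorem nrd_transfer {D₁ D₂ : Type} {r₁ r₂ : ℕ}
    (P Q : Set (Fin r₁ → D₁)) (R S : Set (Fin r₂ → D₂))
    (𝓘 : Fin r₂ → Set (Fin r₁)) (hsub : IsSubstructure P Q R S 𝓘) (m n : ℕ)
    (hne : Nonempty ((j : Fin r₂) × (↥(𝓘 j) → Fin m)))
    (f : ((j : Fin r₂) × (↥(𝓘 j) → Fin m)) → Fin n) (hf : Function.Injective f) :
    NRD P Q m ≤ NRD R S n := by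
  obtain ⟨E, hE, hcard⟩ := nrd_exists (n := m) P Q
  obtain ⟨g, hg1, hg2⟩ := hsub
  let F : (Fin r₁ → Fin m) → (Fin r₂ → Fin n) := fun e j => f ⟨j, fun i => e i.1⟩
  have hF : ∀ e j, Function.invFun f (F e j) = ⟨j, fun i => e i.1⟩ := fun e j =>
    Function.leftInverse_invFun hf _
  let T : (Fin m → D₁) → Fin n → D₂ := fun ψ v =>
    g (Function.invFun f v).1 (fun i => ψ ((Function.invFun f v).2 i))
  have hT : ∀ ψ e, (fun j => T ψ (F e j)) = fun j => g j (fun i => ψ (e i.1)) := by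
    intro ψ e
    funext j
    simp only [T]
    rw [hF e j]
  have hinj : Set.InjOn F E := by
    intro e he e' he' hee
    by_contra hne'
    obtain ⟨ψ, h1, h2⟩ := hE e he
    have k1 := hg1 _ (h1 e' he' (Ne.symm hne'))
    have k2 := (hg2 _ h2).2
    have t1 := hT ψ e
    have t2 := hT ψ e'
    rw [hee] at t1
    apply k2
    have : (fun j => g j (fun i => ψ (e i.1))) ∈ R := by
      rw [← t1, t2]; exact k1
    exact this
  refine le_csSup (nrd_bddAbove R S) ⟨Set.image F E, ?_, ?_⟩
  · rintro _ ⟨e, he, rfl⟩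
    obtain ⟨ψ, h1, h2⟩ := hE e he
    refine ⟨T ψ, ?_, ?_⟩
    · rintro _ ⟨e', he', rfl⟩ hne'
      rw [hT]
      exact hg1 _ (h1 e' he' (fun h => hne' (by rw [h])))
    · rw [hT]
      exact hg2 _ h2
  · rw [Set.InjOn.ncard_image hinj, hcard]

/-- Corollary (richness transfer): if `P | Q` is an `𝓘`-substructure of `R | S`, where each
`I_j` has size at most `c`, `P` and `R` are nonempty, and `NRD(P | Q, n) ≥ a · n^α` for
all `n ≥ 1` (with `α ≥ 1`), then `NRD(R | S, n) ≥ b · n^(α/c)` for all large `n`. -/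
theorem richness_transfer
    {D₁ D₂ : Type} [Fintype D₁] [Fintype D₂] {r₁ r₂ : ℕ}
    (P Q : Set (Fin r₁ → D₁)) (R S : Set (Fin r₂ → D₂))
    (hPQ : P ⊂ Q) (hRS : R ⊂ S)
    (hPne : P.Nonempty) (hRne : R.Nonempty)
    (c : ℕ) (hc : 1 ≤ c)
    (𝓘 : Fin r₂ → Set (Fin r₁)) (hIsize : ∀ j, (𝓘 j).ncard ≤ c)
    (hsub : IsSubstructure P Q R S 𝓘)
    (a α : ℝ) (ha : 0 < a) (hα : 1 ≤ α)
    (hlb : ∀ n : ℕ, 1 ≤ n → a * (n : ℝ) ^ α ≤ (NRD P Q n : ℝ)) :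
    ∃ b > (0:ℝ), ∃ n₀ : ℕ, ∀ n ≥ n₀,
      b * (n : ℝ) ^ (α / (c : ℝ)) ≤ (NRD R S n : ℝ) := by
  classical
  have hr : 0 < r₂ := by
    rcases Nat.eq_zero_or_pos r₂ with h | h
    · subst h
      obtain ⟨x, hx⟩ := hRne
      exfalso
      apply hRS.2
      intro y _
      rwa [Subsingleton.elim y x]
    · exact h
  have hc0 : (0:ℝ) < c := by exact_mod_cast hc
  have hr0 : (0:ℝ) < r₂ := by exact_mod_cast hr
  refine ⟨a * ((1/2) ^ α * ((1 / (r₂:ℝ)) ^ (α / (c:ℝ)))), by positivity, r₂, ?_⟩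
  intro n hn
  have hn' : (r₂:ℝ) ≤ n := by exact_mod_cast hn
  have hx1 : 1 ≤ (n:ℝ) / r₂ := by rwa [le_div_iff₀ hr0, one_mul]
  set y : ℝ := ((n:ℝ) / r₂) ^ (1 / (c:ℝ)) with hy
  have hy1 : 1 ≤ y := Real.one_le_rpow hx1 (by positivity)
  have hy0 : 0 ≤ y := by linarith
  set m : ℕ := ⌊y⌋₊ with hm
  have hm1 : 1 ≤ m := by rw [hm, Nat.one_le_floor_iff]; exact hy1
  have hm1' : (1:ℝ) ≤ m := by exact_mod_cast hm1
  have hmy : (m:ℝ) ≤ y := Nat.floor_le hy0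
  have hmy2 : 1 / 2 * y ≤ m := by
    have := Nat.lt_floor_add_one y
    rw [← hm] at this
    linarith
  have hyc : y ^ c = (n:ℝ) / r₂ := by
    rw [hy, ← Real.rpow_natCast, ← Real.rpow_mul (by positivity), one_div,
      inv_mul_cancel₀ hc0.ne', Real.rpow_one]
  have hmc : r₂ * m ^ c ≤ n := by
    have h1 : (m:ℝ) ^ c ≤ (n:ℝ) / r₂ := hyc ▸ pow_le_pow_left₀ (by positivity) hmy c
    rw [le_div_iff₀ hr0] at h1
    have h2 : ((r₂ * m ^ c : ℕ) : ℝ) ≤ n := by push_cast; linarith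
    exact_mod_cast h2
  have hcard : Fintype.card ((j : Fin r₂) × (↥(𝓘 j) → Fin m)) ≤ Fintype.card (Fin n) := by
    rw [Fintype.card_sigma, Fintype.card_fin]
    refine le_trans ?_ hmc
    calc _ ≤ ∑ j : Fin r₂, m ^ c := by
          refine Finset.sum_le_sum fun j _ => ?_
          rw [Fintype.card_fun, Fintype.card_fin]
          refine Nat.pow_le_pow_right hm1 ?_
          rw [← Nat.card_eq_fintype_card]
          exact hIsize j
      _ = r₂ * m ^ c := by simp
  obtain ⟨f⟩ := Function.Embedding.nonempty_of_card_le hcard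
  have hle := nrd_transfer P Q R S 𝓘 hsub m n ⟨⟨⟨0, hr⟩, fun _ => ⟨0, hm1⟩⟩⟩ f f.injective
  have hle' : (NRD P Q m : ℝ) ≤ NRD R S n := by exact_mod_cast hle
  refine le_trans ?_ (le_trans (hlb m hm1) hle')
  have e1 : y ^ α = (1 / (r₂:ℝ)) ^ (α / (c:ℝ)) * (n:ℝ) ^ (α / (c:ℝ)) := by
    rw [hy, ← Real.rpow_mul (by positivity), ← Real.mul_rpow (by positivity) (by positivity)]
    congr 1 <;> ring
  have e2 : (1 / 2 * y) ^ α ≤ (m:ℝ) ^ α :=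
    Real.rpow_le_rpow (by positivity) hmy2 (by linarith)
  rw [Real.mul_rpow (by norm_num) hy0, e1] at e2
  calc _ = a * ((1/2) ^ α * ((1 / (r₂:ℝ)) ^ (α / (c:ℝ)) * (n:ℝ) ^ (α / (c:ℝ)))) := by ring
    _ ≤ _ := by gcongr
end

section
/- For every proper subset J ⊊ [9] such that π_J BoolBCK⁺ ≠ π_J BoolBCK, there exist constants c > 0 and n₀ such that NRD(π_J BoolBCK | π_J BoolBCK⁺, n) ≥ c · n^{6/5} for all n ≥ n₀. -/
open Set

/-- `BoolBCK⁺`: the six 3×3 permutation matrices, written row-major as 9-tuples over `{0,1}`. -/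
def BoolBCKplus : Set (Fin 9 → Fin 2) :=
  {![1,0,0,0,1,0,0,0,1], ![0,1,0,1,0,0,0,0,1], ![0,0,1,0,1,0,1,0,0],
   ![1,0,0,0,0,1,0,1,0], ![0,0,1,1,0,0,0,1,0], ![0,1,0,0,0,1,1,0,0]}

/-- `BoolBCK = BoolBCK⁺` minus the identity matrix. -/
def BoolBCK : Set (Fin 9 → Fin 2) := BoolBCKplus \ {![1,0,0,0,1,0,0,0,1]}

def relTab : Fin 9 → Fin 9 → Fin 4 := ![
  ![0,3,2,1,1,1,0,0,0],
  ![3,0,2,1,1,1,0,0,0],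
  ![3,2,0,1,1,1,0,0,0],
  ![1,1,1,0,3,2,0,0,0],
  ![1,1,1,3,0,2,0,0,0],
  ![1,1,1,3,2,0,0,0,0],
  ![3,1,0,2,1,0,0,1,0],
  ![1,3,0,1,2,0,1,0,0],
  ![1,0,3,1,0,2,1,0,0]]

def typTab : Fin 9 → Fin 6 → Fin 6 → Fin 6 := ![
  ![![0,1,5,3,4,2],![1,1,5,3,3,5],![4,4,3,3,3,3],![3,3,3,3,3,3],![5,3,3,3,3,5],![2,4,3,3,4,2]],
  ![![0,1,4,2,5,3],![1,1,4,2,2,4],![4,4,4,2,2,4],![3,3,3,5,5,3],![5,3,3,5,5,5],![2,4,4,2,5,5]],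
  ![![0,2,5,1,4,3],![1,5,5,1,4,4],![4,3,3,4,4,4],![3,3,3,4,4,3],![5,5,5,1,1,5],![2,2,5,1,1,5]],
  ![![0,1,5,3,4,2],![1,1,5,3,3,5],![5,5,5,3,3,5],![2,2,2,4,4,2],![4,2,2,4,4,4],![3,5,5,3,4,4]],
  ![![0,1,4,2,5,3],![1,1,4,2,2,4],![5,5,2,2,2,2],![2,2,2,2,2,2],![4,2,2,2,2,4],![3,5,2,2,5,3]],
  ![![0,2,5,1,4,3],![1,5,5,1,4,4],![5,5,5,5,2,2],![2,2,5,5,2,2],![4,4,1,1,4,4],![3,4,1,1,4,3]],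
  ![![0,2,4,1,5,3],![1,4,4,1,5,5],![5,3,3,5,5,5],![3,3,3,5,5,3],![4,4,4,1,1,4],![2,2,4,1,1,4]],
  ![![0,2,4,1,5,3],![1,4,4,1,5,5],![4,4,4,4,2,2],![2,2,4,4,2,2],![5,5,1,1,5,5],![3,5,1,1,5,3]],
  ![![0,2,4,1,5,3],![2,2,4,1,1,4],![5,5,1,1,1,1],![1,1,1,1,1,1],![4,1,1,1,1,4],![3,5,1,1,5,3]]]

def permTab : Fin 6 → Fin 9 → Fin 2 :=
  ![![1,0,0,0,1,0,0,0,1], ![0,1,0,1,0,0,0,0,1], ![0,0,1,0,1,0,1,0,0],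
   ![1,0,0,0,0,1,0,1,0], ![0,0,1,1,0,0,0,1,0], ![0,1,0,0,0,1,1,0,0]]

/-- Neighbouring class on the 6-cycle when the left endpoint is kept. -/
def nxtL : Fin 6 → Fin 6 := ![1,0,3,2,5,4]
/-- Neighbouring class on the 6-cycle when the right endpoint is kept. -/
def nxtR : Fin 6 → Fin 6 := ![5,2,1,4,3,0]

lemma tab_prop : ∀ k r : Fin 9, r ≠ k → ∀ c d : Fin 6,
    (relTab k r = 0 → permTab (typTab k c d) r = permTab (typTab k (nxtL c) d) r) ∧
    (relTab k r = 1 → permTab (typTab k c d) r = permTab (typTab k (nxtR c) d) r) ∧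
    (relTab k r = 2 → permTab (typTab k c d) r = permTab (typTab k c (nxtL d)) r) ∧
    (relTab k r = 3 → permTab (typTab k c d) r = permTab (typTab k c (nxtR d)) r) := by
  decide +kernel

lemma tab_zero : ∀ k : Fin 9, ∀ c d : Fin 6, typTab k c d = 0 ↔ (c = 0 ∧ d = 0) := by
  decide +kernel

lemma permTab_mem (t : Fin 6) : permTab t ∈ BoolBCKplus := by
  fin_cases t <;> simp [permTab, BoolBCKplus]

lemma permTab_mem' (t : Fin 6) (h : t ≠ 0) : permTab t ∈ BoolBCK := by
  refine ⟨permTab_mem t, ?_⟩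
  revert t
  simp only [Set.mem_singleton_iff]
  decide +kernel

section geom
variable {F : Type*} [Field F] [DecidableEq F]

/-- Left endpoint of an edge of the C4-free bipartite graph. -/
def lft (e : F × F × F) : F × F := (e.2.1, e.2.2)
/-- Right endpoint. -/
def rgt (e : F × F × F) : F × F := (e.1, e.2.2 - e.1 * e.2.1)

/-- Class of the edge `e` relative to the edge `o`. -/
def cls (o e : F × F × F) : Fin 6 :=
  if e.2.1 = o.2.1 ∧ e.2.2 = o.2.2 then (if e.1 = o.1 then 0 else 1)
  else if e.2.2 - o.2.2 = e.1 * (e.2.1 - o.2.1) then (if e.1 = o.1 then 5 else 2)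
  else if e.2.2 - o.2.2 = o.1 * (e.2.1 - o.2.1) then 4 else 3

lemma cls_zero (o e : F × F × F) : cls o e = 0 ↔ e = o := by
  obtain ⟨x, y, z⟩ := o
  obtain ⟨a, b, c⟩ := e
  simp only [cls, Prod.mk.injEq]
  split_ifs <;> simp_all

lemma cls_left (o e f : F × F × F) (h : lft e = lft f) :
    cls o f = cls o e ∨ cls o f = nxtL (cls o e) := by
  obtain ⟨x, y, z⟩ := o
  obtain ⟨a, b, c⟩ := e
  obtain ⟨a', b', c'⟩ := f
  simp only [lft, Prod.mk.injEq] at h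
  obtain ⟨rfl, rfl⟩ := h
  simp only [cls]
  split_ifs <;> first | (left; rfl) | (right; rfl) | (exfalso; grind)

lemma cls_right (o e f : F × F × F) (h : rgt e = rgt f) :
    cls o f = cls o e ∨ cls o f = nxtR (cls o e) := by
  obtain ⟨x, y, z⟩ := o
  obtain ⟨a, b, c⟩ := e
  obtain ⟨a', b', c'⟩ := f
  simp only [rgt, Prod.mk.injEq] at h
  obtain ⟨rfl, h⟩ := h
  simp only [cls]
  split_ifs <;> first | (left; rfl) | (right; rfl) | (exfalso; grind)

/-- Vertex (within a part) of type `m` of the pair of edges `w`. -/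
def vtx (m : Fin 4) (w : (F × F × F) × (F × F × F)) : (F × F) × (F × F × F) :=
  match m with
  | 0 => (lft w.1, w.2)
  | 1 => (rgt w.1, w.2)
  | 2 => (lft w.2, w.1)
  | 3 => (rgt w.2, w.1)

lemma vtx_val (k r : Fin 9) (hr : r ≠ k) (o w w' : (F × F × F) × (F × F × F))
    (h : vtx (relTab k r) w = vtx (relTab k r) w') :
    permTab (typTab k (cls o.1 w.1) (cls o.2 w.2)) r =
      permTab (typTab k (cls o.1 w'.1) (cls o.2 w'.2)) r := by
  have T := tab_prop k r hr (cls o.1 w.1) (cls o.2 w.2)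
  generalize hm : relTab k r = m at h T
  fin_cases m <;> simp only [vtx, Prod.mk.injEq] at h <;> obtain ⟨h1, h2⟩ := h
  · rw [← h2]
    rcases cls_left o.1 _ _ h1 with h | h <;> rw [h]
    exact T.1 rfl
  · rw [← h2]
    rcases cls_right o.1 _ _ h1 with h | h <;> rw [h]
    exact T.2.1 rfl
  · rw [← h2]
    rcases cls_left o.2 _ _ h1 with h | h <;> rw [h]
    exact T.2.2.1 rfl
  · rw [← h2]
    rcases cls_right o.2 _ _ h1 with h | h <;> rw [h]
    exact T.2.2.2 rfl

end geom

lemma NRD_ge {ι D : Type*} [Finite ι] (P Q : Set (ι → D)) (n : ℕ) (E : Set (ι → Fin n))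
    (h : IsNRDInstance P Q E) : E.ncard ≤ NRD P Q n := by
  refine le_csSup ⟨Nat.card (ι → Fin n), ?_⟩ ⟨E, h, rfl⟩
  rintro m ⟨E', -, rfl⟩
  exact Set.ncard_le_card E'

lemma key (J : Set (Fin 9)) (k : Fin 9) (hk : k ∉ J)
    (hne : proj J '' BoolBCKplus ≠ proj J '' BoolBCK) (p : ℕ) (hp : p.Prime) (n : ℕ)
    (hn : 9 * p ^ 5 ≤ n) :
    p ^ 6 ≤ NRD (proj J '' BoolBCK) (proj J '' BoolBCKplus) n := by
  have := Fact.mk hp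
  let F := ZMod p
  let X := (F × F × F) × (F × F × F)
  have hI : proj J (permTab 0) ∉ proj J '' BoolBCK := by
    intro hI
    apply hne
    apply Set.Subset.antisymm
    · rintro _ ⟨x, hx, rfl⟩
      by_cases h0 : x = permTab 0
      · rw [h0]; exact hI
      · exact ⟨x, ⟨hx, h0⟩, rfl⟩
    · exact Set.image_mono Set.diff_subset
  obtain ⟨ι⟩ : Nonempty (Fin 9 × ((F × F) × (F × F × F)) ↪ Fin n) := by
    apply Function.Embedding.nonempty_of_card_le
    simp only [F, Fintype.card_prod, Fintype.card_fin, ZMod.card]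
    calc _ = 9 * p ^ 5 := by ring
      _ ≤ n := hn
  let edge : X → (J → Fin n) := fun w j => ι (j.1, vtx (relTab k j.1) w)
  have hψ : ∀ o : X, ∃ ψ : Fin n → Fin 2, ∀ w : X,
      (fun j : J => ψ (edge w j)) =
        proj J (permTab (typTab k (cls o.1 w.1) (cls o.2 w.2))) := by
    intro o
    let val : J × X → Fin 2 := fun jw =>
      permTab (typTab k (cls o.1 jw.2.1) (cls o.2 jw.2.2)) jw.1.1
    let vv : J × X → Fin n := fun jw => edge jw.2 jw.1
    have hf : Function.FactorsThrough val vv := by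
      rintro ⟨j, w⟩ ⟨j', w'⟩ h
      have h' := ι.injective h
      simp only [Prod.mk.injEq] at h'
      obtain ⟨h1, h2⟩ := h'
      obtain rfl := Subtype.ext h1
      exact vtx_val k j.1 (fun hh => hk (hh ▸ j.2)) o w w' h2
    refine ⟨Function.extend vv val (fun _ => 0), fun w => ?_⟩
    funext j
    exact hf.extend_apply (fun _ => 0) (j, w)
  have hP : ∀ o w : X, w ≠ o →
      proj J (permTab (typTab k (cls o.1 w.1) (cls o.2 w.2))) ∈ proj J '' BoolBCK := by
    intro o w hw
    refine ⟨_, permTab_mem' _ ?_, rfl⟩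
    rw [Ne, tab_zero, cls_zero, cls_zero]
    rintro ⟨h1, h2⟩
    exact hw (Prod.ext h1 h2)
  have hO : ∀ o : X, typTab k (cls o.1 o.1) (cls o.2 o.2) = 0 := by
    intro o
    rw [tab_zero, cls_zero, cls_zero]
    exact ⟨rfl, rfl⟩
  have hinj : Function.Injective edge := by
    intro o w h
    by_contra hw
    obtain ⟨ψ, h1⟩ := hψ o
    have h2 := hP o w (fun hh => hw hh.symm)
    rw [← h1 w, ← h, h1 o, hO] at h2
    exact hI h2
  have hnrd : IsNRDInstance (proj J '' BoolBCK) (proj J '' BoolBCKplus) (Set.range edge) := by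
    rintro _ ⟨o, rfl⟩
    obtain ⟨ψ, h1⟩ := hψ o
    refine ⟨ψ, ?_, ?_⟩
    · rintro _ ⟨w, rfl⟩ hw
      rw [h1 w]
      exact hP o w (fun hh => hw (by rw [hh]))
    · rw [h1 o, hO]
      exact ⟨⟨_, permTab_mem 0, rfl⟩, hI⟩
  have hcard : (Set.range edge).ncard = p ^ 6 := by
    rw [← Set.image_univ, Set.ncard_image_of_injective _ hinj, Set.ncard_univ]
    simp only [X, F, Nat.card_eq_fintype_card, Fintype.card_prod, ZMod.card]
    ring
  rw [← hcard]
  exact NRD_ge _ _ n _ hnrd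

/-- Theorem: every nontrivial projection of `BoolBCK | BoolBCK⁺` has a super-linear
NRD lower bound `Ω(n^{6/5})`. -/
theorem BoolBCK_projections
    (J : Set (Fin 9)) (hJ : J ≠ Set.univ)
    (hne : proj J '' BoolBCKplus ≠ proj J '' BoolBCK) :
    ∃ c > (0:ℝ), ∃ n₀ : ℕ, ∀ n ≥ n₀,
      c * (n : ℝ) ^ ((6:ℝ)/5) ≤ (NRD (proj J '' BoolBCK) (proj J '' BoolBCKplus) n : ℝ) := by
  obtain ⟨k, hk⟩ := (Set.ne_univ_iff_exists_notMem J).1 hJ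
  refine ⟨((288:ℝ) ^ ((6:ℝ)/5))⁻¹, by positivity, 288, fun n hn => ?_⟩
  let h := Nat.findGreatest (fun h => 288 * h ^ 5 ≤ n) n
  have h1 : 288 * h ^ 5 ≤ n :=
    Nat.findGreatest_spec (P := fun h => 288 * h ^ 5 ≤ n) (m := 1) (by omega) (by omega)
  have h0 : 1 ≤ h :=
    Nat.le_findGreatest (P := fun h => 288 * h ^ 5 ≤ n) (by omega) (by omega)
  have h2 : n < 288 * (h + 1) ^ 5 := by
    by_contra hc
    push Not at hc
    have hle : h + 1 ≤ n := by
      have : h + 1 ≤ (h + 1) ^ 5 := Nat.le_self_pow (by norm_num) _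
      omega
    have : h + 1 ≤ h := Nat.le_findGreatest (P := fun h => 288 * h ^ 5 ≤ n) hle hc
    omega
  obtain ⟨p, hp, hp1, hp2⟩ := Nat.exists_prime_lt_and_le_two_mul h (by omega)
  have h3 : 9 * p ^ 5 ≤ n := by
    calc 9 * p ^ 5 ≤ 9 * (2 * h) ^ 5 := by gcongr
      _ = 288 * h ^ 5 := by ring
      _ ≤ n := h1
  have h4 : n ≤ 288 * p ^ 5 := by
    have : (h + 1) ^ 5 ≤ p ^ 5 := Nat.pow_le_pow_left hp1 5
    omega
  have h5 : ((p ^ 6 : ℕ) : ℝ) ≤ (NRD (proj J '' BoolBCK) (proj J '' BoolBCKplus) n : ℝ) := by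
    exact_mod_cast key J k hk hne p hp n h3
  refine le_trans ?_ h5
  rw [inv_mul_le_iff₀ (by positivity)]
  have h6 : (n : ℝ) ≤ 288 * (p : ℝ) ^ 5 := by exact_mod_cast h4
  calc (n : ℝ) ^ ((6:ℝ)/5) ≤ (288 * (p : ℝ) ^ 5) ^ ((6:ℝ)/5) := by gcongr
    _ = 288 ^ ((6:ℝ)/5) * ((p : ℝ) ^ 5) ^ ((6:ℝ)/5) :=
      Real.mul_rpow (by norm_num) (by positivity)
    _ = 288 ^ ((6:ℝ)/5) * ((p ^ 6 : ℕ) : ℝ) := by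
      congr 1
      rw [← Real.rpow_natCast, ← Real.rpow_mul (by positivity), Nat.cast_pow,
        ← Real.rpow_natCast]
      norm_num
end

section
/- Let J₁ = [9] ∖ {1} and J₂ = [9] ∖ {2}. For every subset J ⊆ [9] of size 8, either NRD(π_J BoolBCK | π_J BoolBCK⁺, n) = NRD(π_{J₁} BoolBCK | π_{J₁} BoolBCK⁺, n) for all n, or NRD(π_J BoolBCK | π_J BoolBCK⁺, n) = NRD(π_{J₂} BoolBCK | π_{J₂} BoolBCK⁺, n) for all n. -/
open Set

theorem NRD_set_sub {ι₁ ι₂ D : Type*} (e : ι₁ ≃ ι₂) (P₁ Q₁ : Set (ι₁ → D)) (P₂ Q₂ : Set (ι₂ → D))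
    (hP : ∀ x, x ∈ P₂ ↔ x ∘ e ∈ P₁) (hQ : ∀ x, x ∈ Q₂ ↔ x ∘ e ∈ Q₁) (n : ℕ) :
    {m | ∃ E : Set (ι₁ → Fin n), IsNRDInstance P₁ Q₁ E ∧ E.ncard = m} ⊆
    {m | ∃ E : Set (ι₂ → Fin n), IsNRDInstance P₂ Q₂ E ∧ E.ncard = m} := by
  rintro m ⟨E, hE, rfl⟩
  have hinj : Function.Injective (fun f : ι₁ → Fin n => f ∘ e.symm) :=
    e.symm.surjective.injective_comp_right
  refine ⟨(fun f => f ∘ e.symm) '' E, ?_, Set.ncard_image_of_injective _ hinj⟩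
  rintro _ ⟨f, hf, rfl⟩
  obtain ⟨ψ, h1, h2⟩ := hE f hf
  have key : ∀ g : ι₁ → Fin n,
      (fun i => ψ ((g ∘ e.symm) i)) ∘ e = fun i => ψ (g i) := by
    intro g; funext i; simp
  refine ⟨ψ, ?_, ?_, ?_⟩
  · rintro _ ⟨g, hg, rfl⟩ hne
    refine (hP _).2 ?_
    rw [key]
    exact h1 g hg (fun h => hne (by rw [h]))
  · refine (hQ _).2 ?_
    rw [key]
    exact h2.1
  · intro h
    have h' := (hP _).1 h
    rw [key] at h'
    exact h2.2 h'

theorem NRD_congr {ι₁ ι₂ D : Type*} (e : ι₁ ≃ ι₂) (P₁ Q₁ : Set (ι₁ → D)) (P₂ Q₂ : Set (ι₂ → D))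
    (hP : ∀ x, x ∈ P₂ ↔ x ∘ e ∈ P₁) (hQ : ∀ x, x ∈ Q₂ ↔ x ∘ e ∈ Q₁) (n : ℕ) :
    NRD P₁ Q₁ n = NRD P₂ Q₂ n := by
  unfold NRD
  congr 1
  apply Set.Subset.antisymm (NRD_set_sub e _ _ _ _ hP hQ n)
  apply NRD_set_sub e.symm
  · intro x; rw [hP]; simp [Function.comp_assoc]
  · intro x; rw [hQ]; simp [Function.comp_assoc]

/-- Simultaneous permutation of rows and columns. -/
def cellPerm (σ : Equiv.Perm (Fin 3)) : Equiv.Perm (Fin 9) :=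
  (finProdFinEquiv (m := 3) (n := 3)).symm.trans
    ((Equiv.prodCongr σ σ).trans (finProdFinEquiv (m := 3) (n := 3)))

theorem cellPerm_symm (σ : Equiv.Perm (Fin 3)) : (cellPerm σ).symm = cellPerm σ.symm := rfl

theorem cellPerm_id (σ : Equiv.Perm (Fin 3)) :
    (![1,0,0,0,1,0,0,0,1] : Fin 9 → Fin 2) ∘ cellPerm σ = ![1,0,0,0,1,0,0,0,1] := by
  revert σ; decide

theorem cellPerm_plus (σ : Equiv.Perm (Fin 3)) :
    ∀ y ∈ BoolBCKplus, y ∘ cellPerm σ ∈ BoolBCKplus := by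
  unfold BoolBCKplus
  simp only [Set.mem_insert_iff, Set.mem_singleton_iff, forall_eq_or_imp, forall_eq]
  refine ⟨?_, ?_, ?_, ?_, ?_, ?_⟩ <;> revert σ <;> decide

theorem cellPerm_BCK (σ : Equiv.Perm (Fin 3)) :
    ∀ y ∈ BoolBCK, y ∘ cellPerm σ ∈ BoolBCK := by
  rintro y ⟨h1, h2⟩
  refine ⟨cellPerm_plus σ y h1, fun h => h2 ?_⟩
  rw [Set.mem_singleton_iff] at h ⊢
  rw [← cellPerm_id σ] at h
  exact (cellPerm σ).surjective.injective_comp_right h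

theorem proj_transport (τ : Equiv.Perm (Fin 9)) (a b : Fin 9)
    (e : ({a}ᶜ : Set (Fin 9)) ≃ ({b}ᶜ : Set (Fin 9))) (he : ∀ i, (e i).1 = τ i.1)
    (B : Set (Fin 9 → Fin 2)) (h1 : ∀ y ∈ B, y ∘ τ ∈ B) (h2 : ∀ y ∈ B, y ∘ τ.symm ∈ B)
    (x : ({b}ᶜ : Set (Fin 9)) → Fin 2) :
    x ∈ proj ({b}ᶜ : Set (Fin 9)) '' B ↔ x ∘ e ∈ proj ({a}ᶜ : Set (Fin 9)) '' B := by
  constructor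
  · rintro ⟨y, hy, rfl⟩
    refine ⟨y ∘ τ, h1 y hy, ?_⟩
    funext i
    simp [proj, he]
  · rintro ⟨y, hy, hyx⟩
    refine ⟨y ∘ τ.symm, h2 y hy, ?_⟩
    funext i
    obtain ⟨k, rfl⟩ := e.surjective i
    have := congrFun hyx k
    simpa [proj, he] using this

theorem NRD_cell (σ : Equiv.Perm (Fin 3)) (a b : Fin 9) (hab : cellPerm σ a = b) (n : ℕ) :
    NRD (proj ({a}ᶜ : Set (Fin 9)) '' BoolBCK) (proj ({a}ᶜ : Set (Fin 9)) '' BoolBCKplus) n =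
    NRD (proj ({b}ᶜ : Set (Fin 9)) '' BoolBCK) (proj ({b}ᶜ : Set (Fin 9)) '' BoolBCKplus) n := by
  let e : ({a}ᶜ : Set (Fin 9)) ≃ ({b}ᶜ : Set (Fin 9)) :=
    (cellPerm σ).subtypeEquiv (fun i => by
      simp only [Set.mem_compl_iff, Set.mem_singleton_iff]
      rw [← hab, (cellPerm σ).injective.eq_iff])
  have he : ∀ i, (e i).1 = cellPerm σ i.1 := fun i => rfl
  exact NRD_congr e _ _ _ _
    (proj_transport (cellPerm σ) a b e he _ (cellPerm_BCK σ) (cellPerm_BCK σ.symm))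
    (proj_transport (cellPerm σ) a b e he _ (cellPerm_plus σ) (cellPerm_plus σ.symm)) n

theorem cell_orbit : ∀ a : Fin 9, (∃ σ, cellPerm σ a = 0) ∨ (∃ σ, cellPerm σ a = 1) := by
  decide

/-- Lemma (symmetry breaking): for every `J ⊆ [9]` of size 8, the conditional NRD of
`π_J BoolBCK | π_J BoolBCK⁺` coincides (for all `n`) with that of the projection away
from coordinate 1 (`J₁ = [9] ∖ {1}`) or the projection away from coordinate 2
(`J₂ = [9] ∖ {2}`).  (Coordinates are 0-indexed as `Fin 9`.) -/
theorem BoolBCK_projection_symmetry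
    (J : Set (Fin 9)) (hJ : J.ncard = 8) :
    (∀ n : ℕ,
      NRD (proj J '' BoolBCK) (proj J '' BoolBCKplus) n =
      NRD (proj ({0}ᶜ : Set (Fin 9)) '' BoolBCK)
          (proj ({0}ᶜ : Set (Fin 9)) '' BoolBCKplus) n) ∨
    (∀ n : ℕ,
      NRD (proj J '' BoolBCK) (proj J '' BoolBCKplus) n =
      NRD (proj ({1}ᶜ : Set (Fin 9)) '' BoolBCK)
          (proj ({1}ᶜ : Set (Fin 9)) '' BoolBCKplus) n) := by
  obtain ⟨a, rfl⟩ : ∃ a, J = {a}ᶜ := by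
    have h := Set.ncard_add_ncard_compl J
    rw [hJ, Nat.card_eq_fintype_card, Fintype.card_fin] at h
    obtain ⟨a, ha⟩ := Set.ncard_eq_one.1 (by omega : Jᶜ.ncard = 1)
    exact ⟨a, by rw [← ha, compl_compl]⟩
  rcases cell_orbit a with ⟨σ, h⟩ | ⟨σ, h⟩
  · exact Or.inl (NRD_cell σ a 0 h)
  · exact Or.inr (NRD_cell σ a 1 h)
end

section
/- Let J₁ = [9] ∖ {1}, so that π_{J₁} BoolBCK ⊊ π_{J₁} BoolBCK⁺ ⊆ {0,1}^8. There exists a sequence 𝓘 = (I₂, I₃, …, I₉) of subsets of [4], each of size 3, such that (C₆* | C₆) ⊠ (C₆* | C₆) is an 𝓘-substructure of π_{J₁} BoolBCK | π_{J₁} BoolBCK⁺. -/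
open Set

/-- The 6-cycle `C₆` as a binary predicate over `{0,1,2}`. -/
def C6 : Set (Fin 2 → Fin 3) := {![0,0], ![0,1], ![1,0], ![1,2], ![2,1], ![2,2]}

/-- `C₆* = C₆ ∖ {(0,0)}`. -/
def C6star : Set (Fin 2 → Fin 3) := C6 \ {![0,0]}

namespace BoxProof

/-- The six permutation matrices as a list. -/
def mats : List (Fin 9 → Fin 2) :=
  [![1,0,0,0,1,0,0,0,1], ![0,1,0,1,0,0,0,0,1], ![0,0,1,0,1,0,1,0,0],
   ![1,0,0,0,0,1,0,1,0], ![0,0,1,1,0,0,0,1,0], ![0,1,0,0,0,1,1,0,0]]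

/-- The six pairs of `C6`. -/
def prs : List (Fin 3 × Fin 3) := [(0,0), (0,1), (1,0), (1,2), (2,1), (2,2)]

/-- The coordinate that entry `j` ignores. -/
def miss : Fin 9 → Fin 2 ⊕ Fin 2 :=
  ![.inl 0, .inl 1, .inl 0, .inr 0, .inl 1, .inl 0, .inr 1, .inl 1, .inr 1]

/-- The inputs (ignored coordinate set to `0`) on which entry `j` equals `1`. -/
def ones : Fin 9 → List (Fin 3 × Fin 3 × Fin 3 × Fin 3) :=
  ![[],
    [(0, 0, 0, 1), (0, 0, 1, 2), (1, 0, 0, 0), (1, 0, 0, 1)],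
    [(0, 0, 1, 0), (0, 0, 2, 1), (0, 1, 0, 0), (0, 1, 1, 0), (0, 2, 1, 2), (0, 2, 2, 2)],
    [(0, 0, 0, 1), (1, 0, 0, 0), (1, 0, 0, 1), (1, 2, 0, 2), (2, 1, 0, 0), (2, 2, 0, 2)],
    [(0, 0, 0, 0), (0, 0, 1, 0)],
    [(0, 0, 1, 2), (0, 0, 2, 2), (0, 1, 0, 1), (0, 1, 1, 2), (0, 1, 2, 1), (0, 1, 2, 2),
     (0, 2, 0, 0), (0, 2, 0, 1), (0, 2, 1, 0), (0, 2, 2, 1)],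
    [(0, 0, 1, 0), (0, 1, 0, 0), (0, 1, 1, 0), (1, 2, 0, 0)],
    [(0, 0, 2, 1), (0, 0, 2, 2), (1, 0, 1, 0), (1, 0, 1, 2), (1, 0, 2, 1), (1, 0, 2, 2),
     (2, 0, 0, 0), (2, 0, 0, 1), (2, 0, 1, 0), (2, 0, 1, 2), (2, 0, 2, 1), (2, 0, 2, 2)],
    [(0, 0, 0, 0), (1, 0, 0, 0)]]

/-- The value of entry `j`. -/
def ent (j : Fin 9) (x : Fin 2 ⊕ Fin 2 → Fin 3) : Fin 2 :=
  if (x (.inl 0), x (.inl 1), x (.inr 0), x (.inr 1)) ∈ ones j then 1 else 0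

/-- Set the ignored coordinate to `0`. -/
def msk (j : Fin 9) (x : Fin 2 ⊕ Fin 2 → Fin 3) : Fin 2 ⊕ Fin 2 → Fin 3 :=
  fun i => if i ≠ miss j then x i else 0

set_option maxRecDepth 100000 in
set_option maxHeartbeats 4000000 in
theorem core : ∀ p ∈ prs, ∀ q ∈ prs, ∃ M ∈ mats,
    (∀ j : Fin 9, j ≠ 0 → ent j (msk j (Sum.elim ![p.1, p.2] ![q.1, q.2])) = M j) ∧
    (M = ![1,0,0,0,1,0,0,0,1] ↔ p = (0,0) ∧ q = (0,0)) := by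
  decide

set_option maxRecDepth 100000 in
theorem inj : ∀ M ∈ mats, (∀ j : Fin 9, j ≠ 0 → M j = ![1,0,0,0,1,0,0,0,1] j) →
    M = ![1,0,0,0,1,0,0,0,1] := by
  decide

theorem mem_plus (M : Fin 9 → Fin 2) : M ∈ BoolBCKplus ↔ M ∈ mats := by
  simp [BoolBCKplus, mats]

theorem mem_C6 (u : Fin 2 → Fin 3) (h : u ∈ C6) : (u 0, u 1) ∈ prs := by
  simp only [C6, Set.mem_insert_iff, Set.mem_singleton_iff] at h
  rcases h with rfl | rfl | rfl | rfl | rfl | rfl <;> decide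

theorem pair_eq (u : Fin 2 → Fin 3) : ![u 0, u 1] = u := by
  ext i; fin_cases i <;> rfl

theorem core' (x : Fin 2 ⊕ Fin 2 → Fin 3) (hx : x ∈ boxQ C6 C6) : ∃ M ∈ BoolBCKplus,
    (∀ j : Fin 9, j ≠ 0 → ent j (msk j x) = M j) ∧
    (M = ![1,0,0,0,1,0,0,0,1] ↔
      (fun i => x (Sum.inl i)) = ![0,0] ∧ (fun i => x (Sum.inr i)) = ![0,0]) := by
  obtain ⟨M, hM, h1, h2⟩ := core _ (mem_C6 _ hx.1) _ (mem_C6 _ hx.2)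
  refine ⟨M, (mem_plus M).2 hM, ?_, h2.trans ?_⟩
  · have e : Sum.elim ![x (.inl 0), x (.inl 1)] ![x (.inr 0), x (.inr 1)] = x := by
      ext i; rcases i with i | i <;> fin_cases i <;> rfl
    simpa only [e] using h1
  · simp [funext_iff, Fin.forall_fin_two]

end BoxProof

/-- Lemma: with J₁ = [9] ∖ {1} (0-indexed: the complement of {0} in `Fin 9`), there is a
sequence `𝓘` of subsets of [4] (here: of `Fin 2 ⊕ Fin 2`), each of size 3, such that
`(C₆* | C₆) ⊠ (C₆* | C₆)` is an `𝓘`-substructure of the projection of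
`BoolBCK | BoolBCK⁺` onto the coordinates in J₁ = [9] ∖ {1}. -/
theorem boxC6_substructure_of_BoolBCK_proj :
    ∃ 𝓘 : ↥({0}ᶜ : Set (Fin 9)) → Set (Fin 2 ⊕ Fin 2),
      (∀ j, (𝓘 j).ncard = 3) ∧
      IsSubstructure (boxP C6star C6 C6star C6) (boxQ C6 C6)
        (proj ({0}ᶜ : Set (Fin 9)) '' BoolBCK)
        (proj ({0}ᶜ : Set (Fin 9)) '' BoolBCKplus) 𝓘 := by
  classical
  have key : ∀ x : Fin 2 ⊕ Fin 2 → Fin 3, ∀ j : Fin 9,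
      (fun i => if h : i ≠ BoxProof.miss j then
        (fun i : ↥({BoxProof.miss j}ᶜ : Set (Fin 2 ⊕ Fin 2)) => x i.1) ⟨i, h⟩ else 0)
        = BoxProof.msk j x := by
    intro x j
    ext i
    by_cases h : i = BoxProof.miss j <;> simp [BoxProof.msk, h]
  refine ⟨fun j => {BoxProof.miss j.1}ᶜ, ?_, ?_⟩
  · intro j
    rw [Set.ncard_compl, Set.ncard_singleton]
    simp
  · refine ⟨fun j y => BoxProof.ent j.1
      (fun i => if h : i ≠ BoxProof.miss j.1 then y ⟨i, h⟩ else 0), ?_, ?_⟩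
    · intro x hx
      have hQ : x ∈ boxQ C6 C6 := by
        rcases hx with h | h
        · exact ⟨h.1.1, h.2⟩
        · exact ⟨h.1, h.2.1⟩
      obtain ⟨M, hM, h1, h2⟩ := BoxProof.core' x hQ
      refine ⟨M, ⟨hM, ?_⟩, ?_⟩
      · intro hid
        have h3 := h2.1 hid
        rcases hx with h | h
        · exact h.1.2 h3.1
        · exact h.2.2 h3.2
      · funext j
        simp only [key]
        exact (h1 j.1 j.2).symm
    · intro x hx
      obtain ⟨hQ, hP⟩ := hx
      obtain ⟨M, hM, h1, h2⟩ := BoxProof.core' x hQ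
      have e1 : (fun i => x (Sum.inl i)) = ![0,0] := by
        by_contra h
        exact hP (Or.inl ⟨⟨hQ.1, h⟩, hQ.2⟩)
      have e2 : (fun i => x (Sum.inr i)) = ![0,0] := by
        by_contra h
        exact hP (Or.inr ⟨hQ.1, ⟨hQ.2, h⟩⟩)
      have hid := h2.2 ⟨e1, e2⟩
      refine ⟨⟨M, hM, ?_⟩, ?_⟩
      · funext j
        simp only [key]
        exact (h1 j.1 j.2).symm
      · rintro ⟨N, ⟨hN, hN'⟩, hE⟩
        apply hN'
        apply BoxProof.inj N ((BoxProof.mem_plus N).1 hN)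
        intro j hj
        have := congrFun hE ⟨j, hj⟩
        simp only [key] at this
        rw [← hid, ← h1 j hj]
        exact this
end

section
/- Let R₁ | S₁ := (C₆* | C₆) ⊠ ({1,2} | {0,1,2}), a conditional predicate of arity 3 over the domain {0,1,2}. There exist constants C > 0 and m₀ such that for every integer m ≥ m₀ there is a 3-partite non-redundant instance H = (V₁, V₂, V₃, E) of CSP(R₁ | S₁) with exactly m edges satisfying |π_I E| ≤ C · m^{3/4} for every proper subset I ⊊ [3]. -/
open Set

/-- The unary conditional predicate `{1,2} | {0,1,2}` over the domain `{0,1,2}`. -/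
def U12 : Set (Fin 1 → Fin 3) := {x | x 0 = 1 ∨ x 0 = 2}

/-- Point-line incidence in the affine plane. -/
def Inc {F : Type} [Field F] (v w : F × F) : Prop := v.2 = w.1 * v.1 + w.2

lemma inc_no_rect {F : Type} [Field F] {x v y w : F × F} (h1 : Inc x y) (h2 : Inc x w)
    (h3 : Inc v y) (h4 : Inc v w) : v = x ∨ w = y := by
  obtain ⟨a, b⟩ := x
  obtain ⟨c, d⟩ := v
  obtain ⟨s, t⟩ := y
  obtain ⟨s', t'⟩ := w
  simp only [Inc] at h1 h2 h3 h4
  have key : (s' - s) * (c - a) = 0 := by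
    linear_combination h2 - h1 + h3 - h4
  rcases mul_eq_zero.1 key with h | h
  · right
    have hs : s' = s := sub_eq_zero.1 h
    subst hs
    have : t' = t := by linear_combination h1 - h2
    rw [this]
  · left
    have hc : c = a := sub_eq_zero.1 h
    subst hc
    have : d = b := by linear_combination h3 - h1
    rw [this]

/-- The edge parametrised by four field elements. -/
def edgeOf {F : Type} [Field F] (q : F × F × F × F) : Fin 2 ⊕ Fin 1 → F × F :=
  Sum.elim ![(q.1, q.2.1 * q.1 + q.2.2.1), (q.2.1, q.2.2.1)] ![(q.2.2.2, 0)]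

lemma edgeOf_inj {F : Type} [Field F] : Function.Injective (edgeOf (F := F)) := by
  rintro ⟨a, s, t, z⟩ ⟨a', s', t', z'⟩ h
  have h0 := congrFun h (Sum.inl 0)
  have h1 := congrFun h (Sum.inl 1)
  have h2 := congrFun h (Sum.inr 0)
  simp [edgeOf] at h0 h1 h2
  simp [h0.1, h1, h2]

lemma c6_of (i j : Fin 3) (h : ¬ ((i = 1 ∧ j = 1) ∨ (i = 0 ∧ j = 2) ∨ (i = 2 ∧ j = 0)))
    (f : Fin 2 → Fin 3) (h0 : f 0 = i) (h1 : f 1 = j) : f ∈ C6 := by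
  have hf : f = ![i, j] := by
    funext k; fin_cases k <;> simp [h0, h1]
  subst hf
  clear h0 h1
  revert i j
  simp only [C6, Set.mem_insert_iff, Set.mem_singleton_iff]
  decide

open Classical in
lemma nrd_edges {F : Type} [Field F] (S : Set (F × F × F × F)) :
    IsPartiteNRDInstance (V := fun _ : Fin 2 ⊕ Fin 1 => F × F)
      (boxP C6star C6 U12 Set.univ) (boxQ C6 Set.univ) (edgeOf '' S) := by
  rintro e ⟨q, hq, rfl⟩
  have hinc : ∀ q : F × F × F × F, Inc (edgeOf q (Sum.inl 0)) (edgeOf q (Sum.inl 1)) := by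
    intro q; simp [Inc, edgeOf]
  set x := edgeOf q (Sum.inl 0) with hx
  set y := edgeOf q (Sum.inl 1) with hy
  set z := edgeOf q (Sum.inr 0) with hz
  have hxy : Inc x y := hinc q
  let f : F × F → Fin 3 := fun v => if v = x then 0 else if Inc v y then 1 else 2
  let g : F × F → Fin 3 := fun w => if w = y then 0 else if Inc x w then 1 else 2
  let k : F × F → Fin 3 := fun u => if u = z then 0 else 1
  have f0 : ∀ v, f v = 0 → v = x := by
    intro v; simp only [f]; split_ifs <;> simp_all
  have g0 : ∀ v, g v = 0 → v = y := by
    intro v; simp only [g]; split_ifs <;> simp_all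
  have hC : ∀ v w, Inc v w →
      ¬ ((f v = 1 ∧ g w = 1) ∨ (f v = 0 ∧ g w = 2) ∨ (f v = 2 ∧ g w = 0)) := by
    intro v w hvw
    have hr := fun h2 h3 => inc_no_rect (w := w) (v := v) hxy h2 h3 hvw
    simp only [f, g]
    split_ifs <;> simp_all
  refine ⟨Sum.elim ![f, g] ![k], ?_, ?_⟩
  · rintro e' ⟨q', hq', rfl⟩ hne
    have hmem : (fun i : Fin 2 => (Sum.elim ![f, g] ![k] : Fin 2 ⊕ Fin 1 → F × F → Fin 3)
        (Sum.inl i) (edgeOf q' (Sum.inl i))) ∈ C6 :=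
      c6_of _ _ (hC _ _ (hinc q')) _ rfl rfl
    by_cases hu : edgeOf q' (Sum.inr 0) = z
    · left
      refine ⟨⟨hmem, ?_⟩, Set.mem_univ _⟩
      intro h
      have h0 : f (edgeOf q' (Sum.inl 0)) = 0 := congrFun h 0
      have h1 : g (edgeOf q' (Sum.inl 1)) = 0 := congrFun h 1
      apply hne
      funext i
      rcases i with i | i
      · fin_cases i
        · exact f0 _ h0
        · exact g0 _ h1
      · fin_cases i
        exact hu
    · right
      refine ⟨hmem, Or.inl ?_⟩
      show k (edgeOf q' (Sum.inr 0)) = 1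
      simp [k, hu]
  · have fx : f x = 0 := by simp [f]
    have gy : g y = 0 := by simp [g]
    have kz : k z = 0 := by simp [k]
    refine ⟨⟨c6_of _ _ (hC _ _ hxy) _ rfl rfl, Set.mem_univ _⟩, ?_⟩
    rintro (⟨⟨-, h⟩, -⟩ | ⟨-, h⟩)
    · apply h
      show _ = _
      funext i
      fin_cases i
      · exact fx
      · exact gy
    · have h' : k z = 1 ∨ k z = 2 := h
      rw [kz] at h'
      revert h'
      decide

lemma proj_card {F : Type} [Field F] [Fintype F] (S : Set (F × F × F × F))
    (I : Set (Fin 2 ⊕ Fin 1)) (hI : I ≠ Set.univ) :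
    (proj (X := fun _ : Fin 2 ⊕ Fin 1 => F × F) I '' (edgeOf '' S)).ncard
      ≤ Fintype.card F ^ 3 := by
  have main : ∀ G : F × F × F → (Fin 2 ⊕ Fin 1 → F × F),
      (∀ q : F × F × F × F, ∃ r, ∀ i ∈ I, edgeOf q i = G r i) →
      (proj (X := fun _ : Fin 2 ⊕ Fin 1 => F × F) I '' (edgeOf '' S)).ncard
        ≤ Fintype.card F ^ 3 := by
    intro G hG
    have hsub : (proj (X := fun _ : Fin 2 ⊕ Fin 1 => F × F) I '' (edgeOf '' S)) ⊆
        (fun r => proj (X := fun _ : Fin 2 ⊕ Fin 1 => F × F) I (G r)) '' Set.univ := by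
      rintro _ ⟨_, ⟨q, -, rfl⟩, rfl⟩
      obtain ⟨r, hr⟩ := hG q
      refine ⟨r, Set.mem_univ _, ?_⟩
      funext i
      exact (hr i.1 i.2).symm
    calc _ ≤ _ := Set.ncard_le_ncard hsub (Set.toFinite _)
      _ ≤ (Set.univ : Set (F × F × F)).ncard := Set.ncard_image_le (Set.toFinite _)
      _ = Fintype.card F ^ 3 := by
        rw [Set.ncard_univ, Nat.card_eq_fintype_card]
        simp only [Fintype.card_prod]
        ring
  obtain ⟨j, hj⟩ := (Set.ne_univ_iff_exists_notMem I).1 hI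
  rcases j with j | j
  · fin_cases j
    · refine main (fun r => Sum.elim ![(0, 0), (r.1, r.2.1)] ![(r.2.2, 0)]) ?_
      intro q
      refine ⟨(q.2.1, q.2.2.1, q.2.2.2), ?_⟩
      rintro (i | i) hi
      · fin_cases i
        · exact absurd hi hj
        · rfl
      · fin_cases i; rfl
    · refine main (fun r => Sum.elim ![(r.1, r.2.1), (0, 0)] ![(r.2.2, 0)]) ?_
      intro q
      refine ⟨(q.1, q.2.1 * q.1 + q.2.2.1, q.2.2.2), ?_⟩
      rintro (i | i) hi
      · fin_cases i
        · rfl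
        · exact absurd hi hj
      · fin_cases i; rfl
  · fin_cases j
    refine main (fun r => Sum.elim ![(r.1, r.2.1 * r.1 + r.2.2), (r.2.1, r.2.2)] ![(0, 0)]) ?_
    intro q
    refine ⟨(q.1, q.2.1, q.2.2.1), ?_⟩
    rintro (i | i) hi
    · fin_cases i <;> rfl
    · fin_cases i
      exact absurd hi hj

/-- Lemma: for all but finitely many `m`, `CSP(R₁ | S₁)` with
`R₁ | S₁ = (C₆* | C₆) ⊠ ({1,2} | {0,1,2})` has a 3-partite non-redundant instance with
exactly `m` edges all of whose proper projections have at most `C · m^{3/4}` edges. -/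
theorem R1S1_shrinking_instances :
    ∃ C > (0:ℝ), ∃ m₀ : ℕ, ∀ m ≥ m₀,
      ∃ (V : Fin 2 ⊕ Fin 1 → Type) (_ : ∀ i, Finite (V i)) (E : Set (∀ i, V i)),
        IsPartiteNRDInstance (boxP C6star C6 U12 Set.univ) (boxQ C6 Set.univ) E ∧
        E.ncard = m ∧
        ∀ I : Set (Fin 2 ⊕ Fin 1), I ≠ Set.univ →
          ((proj I '' E).ncard : ℝ) ≤ C * (m : ℝ) ^ ((3:ℝ)/4) := by
  refine ⟨64, by norm_num, 1, fun m hm => ?_⟩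
  have hm1 : (1:ℝ) ≤ m := by exact_mod_cast hm
  set t : ℝ := (m:ℝ) ^ ((1:ℝ)/4) with ht
  have ht1 : 1 ≤ t := Real.one_le_rpow hm1 (by norm_num)
  have ht4 : t ^ 4 = m := by
    rw [ht, ← Real.rpow_natCast, ← Real.rpow_mul (by linarith)]; norm_num
  have ht3 : (m:ℝ) ^ ((3:ℝ)/4) = t ^ 3 := by
    rw [ht, ← Real.rpow_natCast, ← Real.rpow_mul (by linarith)]; norm_num
  have hn1 : t ≤ ⌈t⌉₊ := Nat.le_ceil t
  have hn2 : (⌈t⌉₊ : ℝ) < t + 1 := Nat.ceil_lt_add_one (by linarith)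
  have hn0 : ⌈t⌉₊ ≠ 0 := by
    intro h; rw [h] at hn1; norm_num at hn1; linarith
  obtain ⟨p, hp, hp1, hp2⟩ := Nat.exists_prime_lt_and_le_two_mul ⌈t⌉₊ hn0
  haveI : Fact p.Prime := ⟨hp⟩
  have hp1' : (⌈t⌉₊ : ℝ) < p := by exact_mod_cast hp1
  have hp2' : (p : ℝ) ≤ 2 * ⌈t⌉₊ := by exact_mod_cast hp2
  have hmp : m ≤ p ^ 4 := by
    have : (m : ℝ) ≤ (p:ℝ) ^ 4 := by
      rw [← ht4]
      exact pow_le_pow_left₀ (by linarith) (by linarith) 4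
    exact_mod_cast this
  have hcard : m ≤ (Finset.univ : Finset (ZMod p × ZMod p × ZMod p × ZMod p)).card := by
    simp only [Finset.card_univ, Fintype.card_prod, ZMod.card]
    calc m ≤ p ^ 4 := hmp
      _ = _ := by ring
  obtain ⟨S, -, hS⟩ := Finset.exists_subset_card_eq hcard
  refine ⟨fun _ => ZMod p × ZMod p, fun _ => inferInstance, edgeOf '' (S : Set _),
    nrd_edges _, ?_, ?_⟩
  · rw [Set.ncard_image_of_injective _ edgeOf_inj, Set.ncard_coe_finset, hS]
  · intro I hI
    have h := proj_card (S : Set (ZMod p × ZMod p × ZMod p × ZMod p)) I hI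
    rw [ZMod.card] at h
    have h' : ((proj (X := fun _ : Fin 2 ⊕ Fin 1 => ZMod p × ZMod p) I ''
        (edgeOf '' (S : Set _))).ncard : ℝ) ≤ (p:ℝ) ^ 3 := by exact_mod_cast h
    refine h'.trans ?_
    rw [ht3]
    calc (p:ℝ) ^ 3 ≤ (4 * t) ^ 3 := pow_le_pow_left₀ (by positivity) (by linarith) 3
      _ = 64 * t ^ 3 := by ring
end

section
/- Let P = {0,1}³ ∖ {(0,0,0)}, Q = {0,1}³, R = {(0,1,2),(0,2,1),(1,0,2),(1,1,1),(1,2,0),(2,0,1),(2,1,0),(2,2,2)} ⊆ {0,1,2}³ (the nonzero solutions of x+y+z ≡ 0 mod 3), and S = R ∪ {(0,0,0)}. Then P | Q is an ({1,2},{1,3},{2,3})-substructure of R | S; that is, there exist maps g₁, g₂, g₃ : {0,1}² → {0,1,2} such that for every x ∈ {0,1}³, (g₁(x₁,x₂), g₂(x₁,x₃), g₃(x₂,x₃)) ∈ R if x ∈ P, and (g₁(x₁,x₂), g₂(x₁,x₃), g₃(x₂,x₃)) ∈ S ∖ R if x = (0,0,0). -/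
open Set

/-- The punctured 3LIN predicate: nonzero solutions of `x + y + z ≡ 0 (mod 3)`. -/
def R3LIN : Set (Fin 3 → Fin 3) :=
  {![0,1,2], ![0,2,1], ![1,0,2], ![1,1,1], ![1,2,0], ![2,0,1], ![2,1,0], ![2,2,2]}

/-- `S = R ∪ {(0,0,0)}`. -/
def S3LIN : Set (Fin 3 → Fin 3) := R3LIN ∪ {![0,0,0]}

/-- `OR₃ = {0,1}³ ∖ {(0,0,0)}`. -/
def OR3 : Set (Fin 3 → Fin 2) := {x | x ≠ ![0,0,0]}

/-- The map `(a, b) ↦ a + b`. -/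
def gA : Fin 2 → Fin 2 → Fin 3 := ![![0,1],![1,2]]

/-- The map `(a, b) ↦ 2a + b`. -/
def gB : Fin 2 → Fin 2 → Fin 3 := ![![0,1],![2,0]]

/-- The map `(a, b) ↦ 2a + 2b`. -/
def gC : Fin 2 → Fin 2 → Fin 3 := ![![0,2],![2,1]]

lemma g_mem_R (x : Fin 3 → Fin 2) (hx : x ∈ OR3) :
    ![gA (x 0) (x 1), gB (x 0) (x 2), gC (x 1) (x 2)] ∈ R3LIN := by
  simp only [OR3, R3LIN, Set.mem_setOf_eq, Set.mem_insert_iff, Set.mem_singleton_iff] at *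
  revert x
  decide

lemma g_mem_S (x : Fin 3 → Fin 2) (hx : x = ![0,0,0]) :
    ![gA (x 0) (x 1), gB (x 0) (x 2), gC (x 1) (x 2)] ∈ S3LIN \ R3LIN := by
  subst hx
  simp only [S3LIN, R3LIN, Set.mem_diff, Set.mem_union, Set.mem_insert_iff,
    Set.mem_singleton_iff]
  decide

/-- `OR₃ | {0,1}³` is an `({1,2},{1,3},{2,3})`-substructure of `R | S` (0-indexed:
`({0,1},{0,2},{1,2})`); that is, there are maps `g₁, g₂, g₃ : {0,1}² → {0,1,2}` with
`(g₁(x₁,x₂), g₂(x₁,x₃), g₃(x₂,x₃)) ∈ R` for `x ∈ OR₃` and `∈ S ∖ R` for `x = (0,0,0)`. -/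
theorem OR3_substructure_of_3LINstar :
    IsSubstructure OR3 Set.univ R3LIN S3LIN
      ![({0,1} : Set (Fin 3)), {0,2}, {1,2}] ∧
    ∃ g₁ g₂ g₃ : Fin 2 → Fin 2 → Fin 3,
      (∀ x : Fin 3 → Fin 2, x ∈ OR3 →
        ![g₁ (x 0) (x 1), g₂ (x 0) (x 2), g₃ (x 1) (x 2)] ∈ R3LIN) ∧
      (∀ x : Fin 3 → Fin 2, x = ![0,0,0] →
        ![g₁ (x 0) (x 1), g₂ (x 0) (x 2), g₃ (x 1) (x 2)] ∈ S3LIN \ R3LIN) := by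
  refine ⟨?_, gA, gB, gC, g_mem_R, g_mem_S⟩
  let g : ∀ j : Fin 3, (↥((![({0,1} : Set (Fin 3)), {0,2}, {1,2}] : Fin 3 → Set (Fin 3)) j)
      → Fin 2) → Fin 3 := fun j => match j with
    | 0 => fun y => gA (y ⟨0, Or.inl rfl⟩) (y ⟨1, Or.inr rfl⟩)
    | 1 => fun y => gB (y ⟨0, Or.inl rfl⟩) (y ⟨2, Or.inr rfl⟩)
    | 2 => fun y => gC (y ⟨1, Or.inl rfl⟩) (y ⟨2, Or.inr rfl⟩)
  have key : ∀ x : Fin 3 → Fin 2, (fun j => g j (fun i => x i.1)) =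
      ![gA (x 0) (x 1), gB (x 0) (x 2), gC (x 1) (x 2)] := by
    intro x
    funext j
    fin_cases j <;> rfl
  refine ⟨g, fun x hx => ?_, fun x hx => ?_⟩
  · rw [key]
    exact g_mem_R x hx
  · rw [key]
    exact g_mem_S x (not_not.mp hx.2)
end

section
/- Let D be a finite domain with {0,1} ⊆ D, let r ≥ 1, and let P ⊊ Q ⊆ D^r with P nonempty. Define OR_r := {0,1}^r ∖ {(0,…,0)} and let R | S := (P | Q) ⊠ (OR_r | {0,1}^r) ⊆ D^{2r}. Then for every n ≥ r, NRD(R, 2n) ≥ NRD(P | Q, n) · C(n, r), where C(n, r) is the binomial coefficient. -/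
open Set

/-- The Boolean cube `{0,1}^r` inside `D^r`. -/
def cube (D : Type*) [Zero D] [One D] (r : ℕ) : Set (Fin r → D) :=
  {x | ∀ i, x i = 0 ∨ x i = 1}

/-- `OR_r = {0,1}^r ∖ {(0,…,0)}`. -/
def ORpred (D : Type*) [Zero D] [One D] (r : ℕ) : Set (Fin r → D) :=
  cube D r \ {fun _ => 0}

theorem nrd_bdd {ι D : Type*} [Finite ι] (P Q : Set (ι → D)) (n : ℕ) :
    BddAbove {m | ∃ E : Set (ι → Fin n), IsNRDInstance P Q E ∧ E.ncard = m} := by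
  refine ⟨(Set.univ : Set (ι → Fin n)).ncard, ?_⟩
  rintro m ⟨E, -, rfl⟩
  exact Set.ncard_le_ncard (Set.subset_univ _) (Set.toFinite _)

theorem nrd_attained {ι D : Type*} [Finite ι] (P Q : Set (ι → D)) (n : ℕ) :
    ∃ E : Set (ι → Fin n), IsNRDInstance P Q E ∧ E.ncard = NRD P Q n := by
  have h := Nat.sSup_mem (s := {m | ∃ E : Set (ι → Fin n), IsNRDInstance P Q E ∧ E.ncard = m})
    ⟨0, ∅, by intro e he; exact he.elim, by simp⟩ (nrd_bdd P Q n)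
  exact h

/-- Theorem (lower bound for de-conditioning): with `R | S = (P | Q) ⊠ (OR_r | {0,1}^r)`,
for every `n ≥ r`, `NRD(R, 2n) ≥ NRD(P | Q, n) · C(n, r)`. -/
theorem deconditioning_lower_bound
    {D : Type} [Fintype D] [Zero D] [One D] (h01 : (0:D) ≠ 1)
    {r : ℕ} (hr : 1 ≤ r)
    (P Q : Set (Fin r → D)) (hPne : P.Nonempty) (hPQ : P ⊂ Q) :
    ∀ n : ℕ, r ≤ n →
      NRD P Q n * n.choose r ≤
        NRD (boxP P Q (ORpred D r) (cube D r)) Set.univ (2 * n) := by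
  classical
  intro n hn
  obtain ⟨E, hE, hcard⟩ := nrd_attained P Q n
  let φ : Fin n ⊕ Fin n ≃ Fin (2 * n) := finSumFinEquiv.trans (finCongr (two_mul n).symm)
  let T := {s : Finset (Fin n) // s.card = r}
  let f : (Fin r → Fin n) × T → (Fin r ⊕ Fin r → Fin (2 * n)) := fun p =>
    Sum.elim (fun i => φ (Sum.inl (p.1 i))) (fun i => φ (Sum.inr (p.2.1.orderEmbOfFin p.2.2 i)))
  have hf : Function.Injective f := by
    rintro ⟨e, s⟩ ⟨e', s'⟩ h
    have h1 : e = e' := by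
      funext i
      have := congrFun h (Sum.inl i)
      simpa [f] using this
    have h2 : s = s' := by
      apply Subtype.ext
      have h3 : (s.1.orderEmbOfFin s.2 : Fin r → Fin n) = s'.1.orderEmbOfFin s'.2 := by
        funext i
        have := congrFun h (Sum.inr i)
        simpa [f] using this
      have := congrArg Set.range h3
      simpa using this
    rw [h1, h2]
  have hTcard : Nat.card T = n.choose r := by
    simp [T, Nat.card_eq_fintype_card]
  have hc : (f '' (E ×ˢ (Set.univ : Set T))).ncard = NRD P Q n * n.choose r := by
    rw [Set.ncard_image_of_injective _ hf, Set.ncard_prod, hcard, Set.ncard_univ, hTcard]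
  rw [← hc]
  refine le_csSup (nrd_bdd _ _ _) ⟨_, ?_, rfl⟩
  rintro _ ⟨⟨e, s⟩, ⟨he, -⟩, rfl⟩
  obtain ⟨ψ, hψ, hψQ, hψP⟩ := hE e he
  let χ : Fin (2 * n) → D := fun v =>
    Sum.elim ψ (fun w => if w ∈ s.1 then (0 : D) else 1) (φ.symm v)
  have hcube : ∀ s' : T, (fun i => if s'.1.orderEmbOfFin s'.2 i ∈ s.1 then (0 : D) else 1)
      ∈ cube D r := by
    intro s' i
    dsimp only
    split_ifs <;> simp
  refine ⟨χ, ?_, Set.mem_univ _, ?_⟩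
  · rintro _ ⟨⟨e', s'⟩, ⟨he', -⟩, rfl⟩ hne
    simp only [boxP, Set.mem_setOf_eq, χ, f, Sum.elim_inl, Sum.elim_inr, Equiv.symm_apply_apply]
    by_cases hee : e' = e
    · right
      subst hee
      refine ⟨hψQ, hcube s', ?_⟩
      intro h0
      apply hne
      have hsub : s'.1 ⊆ s.1 := by
        intro w hw
        have hw' : w ∈ Set.range (s'.1.orderEmbOfFin s'.2) := by simpa using hw
        obtain ⟨i, rfl⟩ := hw'
        by_contra hns
        have := congrFun h0 i
        simp only [hns, if_false] at this
        exact h01 this.symm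
      have : s' = s := Subtype.ext (Finset.eq_of_subset_of_card_le hsub (by rw [s.2, s'.2]))
      rw [this]
    · left
      exact ⟨hψ e' he' hee, hcube s'⟩
  · simp only [boxP, Set.mem_setOf_eq, χ, f, Sum.elim_inl, Sum.elim_inr, Equiv.symm_apply_apply]
    rintro (⟨h, -⟩ | ⟨-, -, h⟩)
    · exact hψP h
    · apply h
      rw [Set.mem_singleton_iff]
      funext i
      simp [Finset.orderEmbOfFin_mem]
end

section
/- Let D be a finite domain with {0,1} ⊆ D, let r ≥ 1, and let P ⊊ Q ⊆ D^r with P nonempty. Define OR_r := {0,1}^r ∖ {(0,…,0)} and let R | S := (P | Q) ⊠ (OR_r | {0,1}^r) ⊆ D^{2r}. Then for every n ≥ 1, NRD(R | S, n) ≤ NRD(P | Q, n) · n^r. -/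
open Set

lemma ncard_le_NRD {ι D : Type*} [Finite ι] {P Q : Set (ι → D)} {n : ℕ} {E : Set (ι → Fin n)}
    (hE : IsNRDInstance P Q E) : E.ncard ≤ NRD P Q n := by
  refine le_csSup ⟨Nat.card (ι → Fin n), ?_⟩ ⟨E, hE, rfl⟩
  rintro m ⟨F, -, rfl⟩
  exact Set.ncard_le_card F

/-- Theorem (upper bound for de-conditioning): with `R | S = (P | Q) ⊠ (OR_r | {0,1}^r)`,
for every `n ≥ 1`, `NRD(R | S, n) ≤ NRD(P | Q, n) · n^r`. -/
theorem deconditioning_upper_bound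
    {D : Type} [Fintype D] [Zero D] [One D] (h01 : (0:D) ≠ 1)
    {r : ℕ} (hr : 1 ≤ r)
    (P Q : Set (Fin r → D)) (hPne : P.Nonempty) (hPQ : P ⊂ Q) :
    ∀ n : ℕ, 1 ≤ n →
      NRD (boxP P Q (ORpred D r) (cube D r)) (boxQ Q (cube D r)) n ≤
        NRD P Q n * n ^ r := by
  intro n _
  classical
  refine csSup_le' ?_
  rintro m ⟨E, hE, rfl⟩
  let F : (Fin r → Fin n) → Set (Fin r → Fin n) := fun b => {a | Sum.elim a b ∈ E}
  have hF : ∀ b, (F b).ncard ≤ NRD P Q n := by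
    intro b
    apply ncard_le_NRD
    intro a ha
    obtain ⟨ψ, h1, h2, h3⟩ := hE _ ha
    simp only [boxP, boxQ, Set.mem_setOf_eq, Sum.elim_inl, Sum.elim_inr, not_or, not_and] at h2 h3
    have hor : (fun i => ψ (b i)) ∉ ORpred D r := h3.2 h2.1
    refine ⟨ψ, ?_, h2.1, fun hp => h3.1 hp h2.2⟩
    intro a' ha' hne
    have hne' : (Sum.elim a' b : Fin r ⊕ Fin r → Fin n) ≠ Sum.elim a b := by
      intro h
      apply hne
      funext i
      exact congrFun h (Sum.inl i)
    rcases h1 _ ha' hne' with h | h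
    · exact h.1
    · exact absurd h.2 hor
  have hsub : E ⊆ ⋃ b ∈ (Finset.univ : Finset (Fin r → Fin n)),
      (fun a => (Sum.elim a b : Fin r ⊕ Fin r → Fin n)) '' F b := by
    intro e he
    have hee : Sum.elim (e ∘ Sum.inl) (e ∘ Sum.inr) = e := Sum.elim_comp_inl_inr e
    simp only [Set.mem_iUnion]
    refine ⟨e ∘ Sum.inr, Finset.mem_univ _, e ∘ Sum.inl, ?_, hee⟩
    change Sum.elim (e ∘ Sum.inl) (e ∘ Sum.inr) ∈ E
    rwa [hee]
  calc E.ncard ≤ _ := Set.ncard_le_ncard hsub (Set.toFinite _)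
    _ ≤ ∑ b : Fin r → Fin n, ((fun a => (Sum.elim a b : Fin r ⊕ Fin r → Fin n)) '' F b).ncard :=
        Finset.set_ncard_biUnion_le _ _
    _ ≤ ∑ _b : Fin r → Fin n, NRD P Q n :=
        Finset.sum_le_sum fun b _ => (Set.ncard_image_le (Set.toFinite _)).trans (hF b)
    _ = NRD P Q n * n ^ r := by simp [mul_comm]
end

section
/- Let D be a finite domain with {0,1} ⊆ D, let r ≥ 1, let Q ⊆ D^r be nonempty, and define S := Q × {0,1}^r ⊆ D^{2r}. Then for every n ≥ 1, NRD(S, n) ≤ n^{r+1}. -/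
open Set

/-- Theorem: for `S = Q × {0,1}^r` with `Q` nonempty, `NRD(S, n) ≤ n^{r+1}`. -/
theorem product_cube_upper_bound
    {D : Type} [Fintype D] [Zero D] [One D] (h01 : (0:D) ≠ 1)
    {r : ℕ} (hr : 1 ≤ r)
    (Q : Set (Fin r → D)) (hQne : Q.Nonempty) :
    ∀ n : ℕ, 1 ≤ n →
      NRD (boxQ Q (cube D r)) Set.univ n ≤ n ^ (r + 1) := by
  intro n hn
  apply csSup_le'
  rintro m ⟨E, hE, rfl⟩
  classical
  by_cases hn1 : n = 1
  · subst hn1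
    have h1 : E.ncard ≤ 1 :=
      (Set.ncard_le_one (Set.toFinite E)).2 (fun a _ b _ => Subsingleton.elim a b)
    simpa using h1
  -- edges owning a private vertex in their second half
  let A : Set (Fin r ⊕ Fin r → Fin n) :=
    {e | e ∈ E ∧ ∃ v, (∃ i, e (Sum.inr i) = v) ∧
      ∀ e' ∈ E, e' ≠ e → ∀ i, e' (Sum.inr i) ≠ v}
  have hA : A.ncard ≤ n := by
    have hch : ∀ e : Fin r ⊕ Fin r → Fin n, ∃ v : Fin n, e ∈ A →
        ((∃ i, e (Sum.inr i) = v) ∧ ∀ e' ∈ E, e' ≠ e → ∀ i, e' (Sum.inr i) ≠ v) := by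
      intro e
      by_cases h : e ∈ A
      · obtain ⟨v, hv⟩ := h.2
        exact ⟨v, fun _ => hv⟩
      · exact ⟨⟨0, hn⟩, fun h' => absurd h' h⟩
    choose f hf using hch
    have hinj : Set.InjOn f A := by
      intro a ha b hb hab
      by_contra hne
      obtain ⟨i, hi⟩ := (hf a ha).1
      exact (hf b hb).2 a ha.1 hne i (hi.trans hab)
    have := Set.ncard_le_ncard_of_injOn (t := Set.univ) f (fun _ _ => Set.mem_univ _) hinj
    simpa [Set.ncard_univ] using this
  have hB : (E \ A).ncard ≤ n ^ r := by
    have hinj : Set.InjOn (fun (e : Fin r ⊕ Fin r → Fin n) (i : Fin r) => e (Sum.inl i))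
        (E \ A) := by
      intro a ha b hb hab
      by_contra hne
      obtain ⟨ψ, h1, -, h2⟩ := hE a ha.1
      apply h2
      refine ⟨?_, ?_⟩
      · have h3 := (h1 b hb.1 (Ne.symm hne)).1
        have h4 : ∀ i, a (Sum.inl i) = b (Sum.inl i) := fun i => congrFun hab i
        simpa only [h4] using h3
      · intro i
        by_contra hc
        refine ha.2 ⟨ha.1, a (Sum.inr i), ⟨i, rfl⟩, ?_⟩
        intro e' he' hne' j hj
        apply hc
        have h5 := (h1 e' he' hne').2 j
        simpa only [hj] using h5
    have := Set.ncard_le_ncard_of_injOn (t := Set.univ) _ (fun _ _ => Set.mem_univ _) hinj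
    simpa [Set.ncard_univ] using this
  have hsplit : E.ncard ≤ A.ncard + (E \ A).ncard := by
    refine le_trans (Set.ncard_le_ncard ?_ (Set.toFinite _)) (Set.ncard_union_le _ _)
    intro e he
    by_cases h : e ∈ A
    · exact Or.inl h
    · exact Or.inr ⟨he, h⟩
  have h2 : 2 ≤ n := by omega
  have hpow : n ≤ n ^ r := Nat.le_self_pow (by omega) n
  have : n ^ r * 2 ≤ n ^ (r + 1) := by
    rw [pow_succ]
    exact Nat.mul_le_mul_left _ h2
  omega
end

section
/- Define, over the domain {0,1,2}: P₁ := {001,111,120,222,212} and Q₁ := P₁ ∪ {000} (arity 3); P₂ := {011,111,120,222,202} and Q₂ := P₂ ∪ {000} (arity 3); P₃ := {0101,1111,1220,2222,2012} and Q₃ := P₃ ∪ {0000} (arity 4). Then there exist constants c₁, c₂, c₃ > 0 and n₀ such that for all n ≥ n₀: NRD(P₁ | Q₁, n) ≥ c₁ · n^{4/3}, NRD(P₂ | Q₂, n) ≥ c₂ · n^{4/3}, and NRD(P₃ | Q₃, n) ≥ c₃ · n^{6/5}. -/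
open Set

/-- `P₁ = π_{{1,3,4}} Cat₅ = {001,111,120,222,212}` over `{0,1,2}`. -/
def CatP1 : Set (Fin 3 → Fin 3) := {![0,0,1], ![1,1,1], ![1,2,0], ![2,2,2], ![2,1,2]}

/-- `Q₁ = P₁ ∪ {000}`. -/
def CatQ1 : Set (Fin 3 → Fin 3) := CatP1 ∪ {![0,0,0]}

/-- `P₂ = π_{{1,2,4}} Cat₅ = {011,111,120,222,202}` over `{0,1,2}`. -/
def CatP2 : Set (Fin 3 → Fin 3) := {![0,1,1], ![1,1,1], ![1,2,0], ![2,2,2], ![2,0,2]}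

/-- `Q₂ = P₂ ∪ {000}`. -/
def CatQ2 : Set (Fin 3 → Fin 3) := CatP2 ∪ {![0,0,0]}

/-- `P₃ = π_{{1,2,3,4}} Cat₅ = {0101,1111,1220,2222,2012}` over `{0,1,2}`. -/
def CatP3 : Set (Fin 4 → Fin 3) :=
  {![0,1,0,1], ![1,1,1,1], ![1,2,2,0], ![2,2,2,2], ![2,0,1,2]}

/-- `Q₃ = P₃ ∪ {0000}`. -/
def CatQ3 : Set (Fin 4 → Fin 3) := CatP3 ∪ {![0,0,0,0]}

/-- From an instance indexed by `Ω` with vertices in a small type `W`, a bound on `NRD`. -/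
lemma nrd_lower {ι Ω W : Type} [Fintype ι] [Fintype Ω] [Fintype W]
    (P Q : Set (ι → Fin 3)) (g : Ω → ι → W) (n : ℕ) (hW : Fintype.card W ≤ n)
    (h : ∀ e, ∃ ψ : W → Fin 3, (∀ f, f ≠ e → (fun i => ψ (g f i)) ∈ P) ∧
      (fun i => ψ (g e i)) ∈ Q \ P) :
    Fintype.card Ω ≤ NRD P Q n := by
  classical
  have hg : Function.Injective g := by
    intro e f hef
    by_contra hne
    obtain ⟨ψ, h1, h2⟩ := h e
    have h3 := h1 f (Ne.symm hne)
    rw [← hef] at h3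
    exact h2.2 h3
  obtain ⟨φ⟩ : Nonempty (W ↪ Fin n) :=
    Function.Embedding.nonempty_of_card_le (by simpa using hW)
  have hinj : Function.Injective (fun (e : Ω) (i : ι) => φ (g e i)) := by
    intro e f hef
    apply hg
    funext i
    exact φ.injective (congrFun hef i)
  unfold NRD
  apply le_csSup
  · refine ⟨Nat.card (ι → Fin n), ?_⟩
    rintro m ⟨E, -, rfl⟩
    exact Set.ncard_le_card E
  · refine ⟨Set.range (fun (e : Ω) (i : ι) => φ (g e i)), ?_, ?_⟩
    · rintro _ ⟨e, rfl⟩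
      obtain ⟨ψ, h1, h2⟩ := h e
      refine ⟨Function.extend φ ψ (fun _ => 0), ?_, ?_⟩
      · rintro _ ⟨f, rfl⟩ hne
        have hfe : f ≠ e := fun hh => hne (by rw [hh])
        simpa [φ.injective.extend_apply] using h1 f hfe
      · simpa only [φ.injective.extend_apply] using h2
    · rw [← Set.image_univ, Set.ncard_image_of_injective _ hinj, Set.ncard_univ,
        Nat.card_eq_fintype_card]

/-- Two distinct points on two common lines force the lines to agree. -/
lemma lin_space {F : Type} [Field F] {a b a' b' m c m' c' : F}
    (h1 : b = m * a + c) (h2 : b = m' * a + c') (h3 : b' = m * a' + c) (h4 : b' = m' * a' + c')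
    (hne : ¬ (a = a' ∧ b = b')) : m = m' ∧ c = c' := by
  have hm : (m - m') * (a - a') = 0 := by linear_combination h2 - h1 + h3 - h4
  rcases mul_eq_zero.mp hm with h | h
  · have hmm : m = m' := sub_eq_zero.mp h
    refine ⟨hmm, ?_⟩
    subst hmm
    linear_combination h2 - h1
  · exfalso
    have haa : a = a' := sub_eq_zero.mp h
    apply hne
    refine ⟨haa, ?_⟩
    subst haa
    rw [h1, h3]

lemma core1 (A B D G H : Prop) [Decidable A] [Decidable B] [Decidable D]
    [Decidable G] [Decidable H] (hGB : G → B) (hGD : G → D) (hAB : A → B)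
    (hABD : ¬ A → B → D → G) (hne : ¬ (A ∧ G ∧ H)) :
    (![if A then 0 else if B then 1 else 2,
      if A then 0 else if D ∧ H then 2 else 1,
      if B then (if G ∧ H then 0 else 1) else 2] : Fin 3 → Fin 3) ∈ CatP1 := by
  by_cases A <;> by_cases B <;> by_cases D <;> by_cases G <;> by_cases H <;>
    simp_all [CatP1]

lemma core2 (A B D G H : Prop) [Decidable A] [Decidable B] [Decidable D]
    [Decidable G] [Decidable H] (hBD : ¬ A → ¬ G → B → D → False)
    (hAB : A → B) (hGD : G → D) (hne : ¬ (A ∧ G ∧ H)) :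
    (![if ¬ G ∧ B then 2 else if G ∧ H then 0 else 1,
      if ¬ A ∧ D then 1 else if A ∧ H then 0 else 2,
      if ¬ G ∧ B then 2 else if ¬ A ∧ D then 1 else 0] : Fin 3 → Fin 3) ∈ CatP2 := by
  by_cases A <;> by_cases B <;> by_cases D <;> by_cases G <;> by_cases H <;>
    simp_all [CatP2]

/- Index `1`: `A` is `K = K₀`, `B` is `K₀ ∈ L`, `D` is `K ∈ L₀`, `G` is `L = L₀`. -/
lemma core3 (A B D G A' B' D' G' : Prop) [Decidable A] [Decidable B] [Decidable D]
    [Decidable G] [Decidable A'] [Decidable B'] [Decidable D'] [Decidable G']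
    (hAB : A → B) (hGD : G → D) (hGB : G → B) (hAD : A → D) (hABD : ¬ A → B → D → G)
    (hAB' : A' → B') (hGD' : G' → D') (hGB' : G' → B') (hAD' : A' → D')
    (hABD' : ¬ A' → B' → D' → G') (hne : ¬ (A ∧ G ∧ A' ∧ G')) :
    (![if A ∧ A' then 0 else if B ∧ (¬ G ∨ A' ∨ ¬ D') then 1 else 2,
      if B ∧ B' ∧ ¬ (G ∧ G') then 1 else if B' ∧ (¬ G' ∨ A ∨ ¬ D) then 0 else 2,
      if A ∧ A' then 0 else if B' ∧ (¬ G' ∨ A ∨ ¬ D) then 1 else 2,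
      if B ∧ B' ∧ ¬ (G ∧ G') then 1 else if B ∧ (¬ G ∨ A' ∨ ¬ D') then 0 else 2]
      : Fin 4 → Fin 3) ∈ CatP3 := by
  by_cases A <;> by_cases B <;> by_cases D <;> by_cases G <;>
  by_cases A' <;> by_cases B' <;> by_cases D' <;> by_cases G' <;>
    simp_all [CatP3]

lemma mem3 {S : Set (Fin 3 → Fin 3)} {h : Fin 3 → Fin 3} (hh : ![h 0, h 1, h 2] ∈ S) : h ∈ S := by
  convert hh using 1
  funext i; fin_cases i <;> rfl

lemma mem4 {S : Set (Fin 4 → Fin 3)} {h : Fin 4 → Fin 3} (hh : ![h 0, h 1, h 2, h 3] ∈ S) :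
    h ∈ S := by
  convert hh using 1
  funext i; fin_cases i <;> rfl

lemma zero_mem1 : (![0, 0, 0] : Fin 3 → Fin 3) ∈ CatQ1 \ CatP1 := by
  simp [CatQ1, CatP1]

lemma zero_mem2 : (![0, 0, 0] : Fin 3 → Fin 3) ∈ CatQ2 \ CatP2 := by
  simp [CatQ2, CatP2]

lemma zero_mem3 : (![0, 0, 0, 0] : Fin 4 → Fin 3) ∈ CatQ3 \ CatP3 := by
  simp [CatQ3, CatP3]

open Classical in
lemma bound1 (F : Type) [Field F] [Fintype F] (n : ℕ) (hn : 3 * Fintype.card F ^ 3 ≤ n) :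
    Fintype.card F ^ 4 ≤ NRD CatP1 CatQ1 n := by
  have key := nrd_lower (Ω := F × F × F × F) (W := Fin 3 × F × F × F) CatP1 CatQ1
    (fun e => ![(0, e.1, e.2.1, e.2.2.1), (1, e.1, e.2.1, e.2.2.2),
      (2, e.2.2.1, e.2.1 - e.2.2.1 * e.1, e.2.2.2)]) n
    (by simp only [Fintype.card_prod, Fintype.card_fin]; convert hn using 1; ring) ?_
  · convert key using 1
    simp only [Fintype.card_prod]; ring
  rintro ⟨a₀, b₀, m₀, i₀⟩
  refine ⟨fun v => (![
      (if v.2.1 = a₀ ∧ v.2.2.1 = b₀ then 0 else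
        if b₀ = v.2.2.2 * a₀ + (v.2.2.1 - v.2.2.2 * v.2.1) then 1 else 2),
      (if v.2.1 = a₀ ∧ v.2.2.1 = b₀ then 0 else
        if v.2.2.1 = m₀ * v.2.1 + (b₀ - m₀ * a₀) ∧ v.2.2.2 = i₀ then 2 else 1),
      (if b₀ = v.2.1 * a₀ + v.2.2.1 then
      (if (v.2.1 = m₀ ∧ v.2.2.1 = b₀ - m₀ * a₀) ∧ v.2.2.2 = i₀ then 0 else 1) else 2)] : Fin 3 → Fin 3) v.1, ?_, ?_⟩
  · rintro ⟨a, b, m, i⟩ hne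
    apply mem3
    refine core1 (a = a₀ ∧ b = b₀) (b₀ = m * a₀ + (b - m * a)) (b = m₀ * a + (b₀ - m₀ * a₀))
      (m = m₀ ∧ b - m * a = b₀ - m₀ * a₀) (i = i₀) ?_ ?_ ?_ ?_ ?_
    · rintro ⟨rfl, h⟩; rw [h]; ring
    · rintro ⟨rfl, h⟩; rw [← h]; ring
    · rintro ⟨rfl, rfl⟩; ring
    · intro h1 h2 h3
      exact lin_space (a := a) (b := b) (a' := a₀) (b' := b₀) (by ring) h3 h2 (by ring) h1
    · rintro ⟨⟨rfl, rfl⟩, ⟨rfl, -⟩, rfl⟩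
      exact hne rfl
  · apply mem3
    convert zero_mem1 using 1
    simp

open Classical in
lemma bound2 (F : Type) [Field F] [Fintype F] (n : ℕ) (hn : 3 * Fintype.card F ^ 3 ≤ n) :
    Fintype.card F ^ 4 ≤ NRD CatP2 CatQ2 n := by
  have key := nrd_lower (Ω := F × F × F × F) (W := Fin 3 × F × F × F) CatP2 CatQ2
    (fun e => ![(0, e.2.2.1, e.2.1 - e.2.2.1 * e.1, e.2.2.2), (1, e.1, e.2.1, e.2.2.2),
      (2, e.1, e.2.1, e.2.2.1)]) n
    (by simp only [Fintype.card_prod, Fintype.card_fin]; convert hn using 1; ring) ?_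
  · convert key using 1
    simp only [Fintype.card_prod]; ring
  rintro ⟨a₀, b₀, m₀, i₀⟩
  refine ⟨fun v => (![
      (if ¬ (v.2.1 = m₀ ∧ v.2.2.1 = b₀ - m₀ * a₀) ∧ b₀ = v.2.1 * a₀ + v.2.2.1 then 2 else
        if (v.2.1 = m₀ ∧ v.2.2.1 = b₀ - m₀ * a₀) ∧ v.2.2.2 = i₀ then 0 else 1),
      (if ¬ (v.2.1 = a₀ ∧ v.2.2.1 = b₀) ∧ v.2.2.1 = m₀ * v.2.1 + (b₀ - m₀ * a₀) then 1 else
        if (v.2.1 = a₀ ∧ v.2.2.1 = b₀) ∧ v.2.2.2 = i₀ then 0 else 2),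
      (if ¬ (v.2.2.2 = m₀ ∧ v.2.2.1 - v.2.2.2 * v.2.1 = b₀ - m₀ * a₀) ∧
          b₀ = v.2.2.2 * a₀ + (v.2.2.1 - v.2.2.2 * v.2.1) then 2 else
        if ¬ (v.2.1 = a₀ ∧ v.2.2.1 = b₀) ∧ v.2.2.1 = m₀ * v.2.1 + (b₀ - m₀ * a₀) then 1
        else 0)] : Fin 3 → Fin 3) v.1, ?_, ?_⟩
  · rintro ⟨a, b, m, i⟩ hne
    apply mem3
    have hAB : a = a₀ ∧ b = b₀ → b₀ = m * a₀ + (b - m * a) := by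
      rintro ⟨rfl, rfl⟩; ring
    have hGD : m = m₀ ∧ b - m * a = b₀ - m₀ * a₀ → b = m₀ * a + (b₀ - m₀ * a₀) := by
      rintro ⟨rfl, h⟩; rw [← h]; ring
    refine core2 (a = a₀ ∧ b = b₀) (b₀ = m * a₀ + (b - m * a)) (b = m₀ * a + (b₀ - m₀ * a₀))
      (m = m₀ ∧ b - m * a = b₀ - m₀ * a₀) (i = i₀) ?_ hAB hGD ?_
    · intro h1 h4 h2 h3
      exact h4 (lin_space (a := a) (b := b) (a' := a₀) (b' := b₀) (by ring) h3 h2 (by ring) h1)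
    · rintro ⟨⟨rfl, rfl⟩, ⟨rfl, -⟩, rfl⟩
      exact hne rfl
  · apply mem3
    convert zero_mem2 using 1
    simp

open Classical in
/-- Edges are pairs of flags `(a, b, m)`, `(a', b', m')`. -/
lemma bound3 (F : Type) [Field F] [Fintype F] (n : ℕ) (hn : 4 * Fintype.card F ^ 5 ≤ n) :
    Fintype.card F ^ 6 ≤ NRD CatP3 CatQ3 n := by
  have key := nrd_lower (Ω := (F × F × F) × (F × F × F)) (W := Fin 4 × (F × F × F) × (F × F))
    CatP3 CatQ3
    (fun e => ![(0, e.1, (e.2.1, e.2.2.1)),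
      (1, e.1, (e.2.2.2, e.2.2.1 - e.2.2.2 * e.2.1)),
      (2, e.2, (e.1.1, e.1.2.1)),
      (3, e.2, (e.1.2.2, e.1.2.1 - e.1.2.2 * e.1.1))]) n
    (by simp only [Fintype.card_prod, Fintype.card_fin]; convert hn using 1; ring) ?_
  · convert key using 1
    simp only [Fintype.card_prod]; ring
  rintro ⟨⟨a₀, b₀, m₀⟩, ⟨a₁, b₁, m₁⟩⟩
  -- predicates for the two planes
  let A : F → F → Prop := fun a b => a = a₀ ∧ b = b₀
  let B : F → F → Prop := fun m c => b₀ = m * a₀ + c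
  let D : F → F → Prop := fun a b => b = m₀ * a + (b₀ - m₀ * a₀)
  let G : F → F → Prop := fun m c => m = m₀ ∧ c = b₀ - m₀ * a₀
  let A' : F → F → Prop := fun a b => a = a₁ ∧ b = b₁
  let B' : F → F → Prop := fun m c => b₁ = m * a₁ + c
  let D' : F → F → Prop := fun a b => b = m₁ * a + (b₁ - m₁ * a₁)
  let G' : F → F → Prop := fun m c => m = m₁ ∧ c = b₁ - m₁ * a₁
  let X : F → F → F → F → F → Fin 3 := fun a b m a' b' =>
    if A a b ∧ A' a' b' then 0 else
      if B m (b - m * a) ∧ (¬ G m (b - m * a) ∨ A' a' b' ∨ ¬ D' a' b') then 1 else 2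
  let Y : F → F → F → F → F → Fin 3 := fun a b m m' c' =>
    if B m (b - m * a) ∧ B' m' c' ∧ ¬ (G m (b - m * a) ∧ G' m' c') then 1 else
      if B' m' c' ∧ (¬ G' m' c' ∨ A a b ∨ ¬ D a b) then 0 else 2
  let Z : F → F → F → F → F → Fin 3 := fun a' b' m' a b =>
    if A a b ∧ A' a' b' then 0 else
      if B' m' (b' - m' * a') ∧ (¬ G' m' (b' - m' * a') ∨ A a b ∨ ¬ D a b) then 1 else 2
  let T : F → F → F → F → F → Fin 3 := fun a' b' m' m c =>
    if B m c ∧ B' m' (b' - m' * a') ∧ ¬ (G m c ∧ G' m' (b' - m' * a')) then 1 else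
      if B m c ∧ (¬ G m c ∨ A' a' b' ∨ ¬ D' a' b') then 0 else 2
  refine ⟨fun v => (![ X v.2.1.1 v.2.1.2.1 v.2.1.2.2 v.2.2.1 v.2.2.2, Y v.2.1.1 v.2.1.2.1 v.2.1.2.2 v.2.2.1 v.2.2.2, Z v.2.1.1 v.2.1.2.1 v.2.1.2.2 v.2.2.1 v.2.2.2,
    T v.2.1.1 v.2.1.2.1 v.2.1.2.2 v.2.2.1 v.2.2.2] : Fin 4 → Fin 3) v.1, ?_, ?_⟩
  · rintro ⟨⟨a, b, m⟩, ⟨a', b', m'⟩⟩ hne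
    apply mem4
    refine core3 (A a b) (B m (b - m * a)) (D a b) (G m (b - m * a))
      (A' a' b') (B' m' (b' - m' * a')) (D' a' b') (G' m' (b' - m' * a'))
      ?_ ?_ ?_ ?_ ?_ ?_ ?_ ?_ ?_ ?_ ?_
    · rintro ⟨rfl, rfl⟩; simp only [B]; ring
    · rintro ⟨rfl, h⟩; simp only [D]; rw [← h]; ring
    · rintro ⟨rfl, h⟩; simp only [B]; rw [h]; ring
    · rintro ⟨rfl, rfl⟩; simp only [D]; ring
    · intro h1 h2 h3
      exact lin_space (a := a) (b := b) (a' := a₀) (b' := b₀) (by ring) h3 h2 (by ring) h1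
    · rintro ⟨rfl, rfl⟩; simp only [B']; ring
    · rintro ⟨rfl, h⟩; simp only [D']; rw [← h]; ring
    · rintro ⟨rfl, h⟩; simp only [B']; rw [h]; ring
    · rintro ⟨rfl, rfl⟩; simp only [D']; ring
    · intro h1 h2 h3
      exact lin_space (a := a') (b := b') (a' := a₁) (b' := b₁) (by ring) h3 h2 (by ring) h1
    · rintro ⟨⟨rfl, rfl⟩, ⟨rfl, -⟩, ⟨rfl, rfl⟩, ⟨rfl, -⟩⟩
      exact hne rfl
  · apply mem4
    convert zero_mem3 using 1
    simp [X, Y, Z, T, A, B, D, G, A', B', D', G']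

/-- Bertrand's postulate gives a prime of the right size. -/
lemma exists_prime_size (A d n : ℕ) (hA : 0 < A) (hd : 0 < d) (hn : A * 2 ^ d ≤ n) :
    ∃ p : ℕ, p.Prime ∧ A * p ^ d ≤ n ∧ n ≤ A * 2 ^ d * p ^ d := by
  let k := Nat.findGreatest (fun k => A * 2 ^ d * k ^ d ≤ n) n
  have h1n : 1 ≤ n := le_trans (Nat.mul_pos hA (by positivity)) hn
  have hk1 : 1 ≤ k := Nat.le_findGreatest h1n (by simpa using hn)
  have hk : A * 2 ^ d * k ^ d ≤ n :=
    Nat.findGreatest_spec (P := fun k => A * 2 ^ d * k ^ d ≤ n) h1n (by simpa using hn)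
  have hk2 : n < A * 2 ^ d * (k + 1) ^ d := by
    by_contra hcon
    push Not at hcon
    have hle : k + 1 ≤ n := by
      calc k + 1 ≤ (k + 1) ^ d := Nat.le_self_pow hd.ne' _
        _ ≤ A * 2 ^ d * (k + 1) ^ d := Nat.le_mul_of_pos_left _ (by positivity)
        _ ≤ n := hcon
    have := Nat.le_findGreatest (P := fun k => A * 2 ^ d * k ^ d ≤ n) hle hcon
    change k + 1 ≤ k at this
    omega
  obtain ⟨p, hp, hkp, hp2⟩ := Nat.exists_prime_lt_and_le_two_mul k (by omega)
  refine ⟨p, hp, ?_, ?_⟩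
  · calc A * p ^ d ≤ A * (2 * k) ^ d := by gcongr
      _ = A * 2 ^ d * k ^ d := by rw [mul_pow, mul_assoc]
      _ ≤ n := hk
  · refine hk2.le.trans ?_
    gcongr
    omega

lemma growth (C d p n N : ℕ) (hC : 0 < C) (hd : 0 < d) (h : n ≤ C * p ^ d)
    (hN : p ^ (d + 1) ≤ N) (r : ℝ) (hr : r = ((d : ℝ) + 1) / d) :
    ((C : ℝ) ^ r)⁻¹ * (n : ℝ) ^ r ≤ (N : ℝ) := by
  have hd' : (0 : ℝ) < d := by exact_mod_cast hd
  have hC' : (0 : ℝ) < C := by exact_mod_cast hC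
  have hr0 : 0 ≤ r := by rw [hr]; positivity
  have h1 : (n : ℝ) ≤ C * (p : ℝ) ^ d := by exact_mod_cast h
  have h2 : (n : ℝ) ^ r ≤ (C : ℝ) ^ r * (p : ℝ) ^ (d + 1) := by
    calc (n : ℝ) ^ r ≤ (C * (p : ℝ) ^ d) ^ r := Real.rpow_le_rpow (by positivity) h1 hr0
      _ = (C : ℝ) ^ r * ((p : ℝ) ^ d) ^ r := Real.mul_rpow (by positivity) (by positivity)
      _ = (C : ℝ) ^ r * (p : ℝ) ^ (d + 1) := by
        congr 1
        rw [← Real.rpow_natCast, ← Real.rpow_mul (by positivity), ← Real.rpow_natCast]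
        congr 1
        rw [hr]
        push_cast
        field_simp
  have hCr : 0 < (C : ℝ) ^ r := Real.rpow_pos_of_pos hC' r
  rw [inv_mul_le_iff₀ hCr]
  refine h2.trans ?_
  have : (p : ℝ) ^ (d + 1) ≤ N := by exact_mod_cast hN
  gcongr

/-- Theorem: the projections of `Cat₅ | Cat₅⁺` have super-linear conditional NRD:
`NRD(P₁|Q₁, n) ≥ c₁ n^{4/3}`, `NRD(P₂|Q₂, n) ≥ c₂ n^{4/3}`, and
`NRD(P₃|Q₃, n) ≥ c₃ n^{6/5}` for all large `n`. -/
theorem catalan_cousins_lower_bounds :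
    ∃ c₁ > (0:ℝ), ∃ c₂ > (0:ℝ), ∃ c₃ > (0:ℝ), ∃ n₀ : ℕ, ∀ n ≥ n₀,
      c₁ * (n : ℝ) ^ ((4:ℝ)/3) ≤ (NRD CatP1 CatQ1 n : ℝ) ∧
      c₂ * (n : ℝ) ^ ((4:ℝ)/3) ≤ (NRD CatP2 CatQ2 n : ℝ) ∧
      c₃ * (n : ℝ) ^ ((6:ℝ)/5) ≤ (NRD CatP3 CatQ3 n : ℝ) := by
  refine ⟨(((3 * 2 ^ 3 : ℕ) : ℝ) ^ ((4:ℝ)/3))⁻¹, by positivity,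
    (((3 * 2 ^ 3 : ℕ) : ℝ) ^ ((4:ℝ)/3))⁻¹, by positivity,
    (((4 * 2 ^ 5 : ℕ) : ℝ) ^ ((6:ℝ)/5))⁻¹, by positivity, 4 * 2 ^ 5, ?_⟩
  intro n hn
  obtain ⟨p, hp, hp1, hp2⟩ := exists_prime_size 3 3 n (by norm_num) (by norm_num) (by omega)
  obtain ⟨q, hq, hq1, hq2⟩ := exists_prime_size 4 5 n (by norm_num) (by norm_num) hn
  have : Fact p.Prime := ⟨hp⟩
  have : Fact q.Prime := ⟨hq⟩
  have b1 := bound1 (ZMod p) n (by rw [ZMod.card]; exact hp1)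
  have b2 := bound2 (ZMod p) n (by rw [ZMod.card]; exact hp1)
  have b3 := bound3 (ZMod q) n (by rw [ZMod.card]; exact hq1)
  rw [ZMod.card] at b1 b2 b3
  exact ⟨growth _ 3 p n _ (by norm_num) (by norm_num) hp2 b1 _ (by norm_num),
    growth _ 3 p n _ (by norm_num) (by norm_num) hp2 b2 _ (by norm_num),
    growth _ 5 q n _ (by norm_num) (by norm_num) hq2 b3 _ (by norm_num)⟩
end

section
/- Let R₁ | S₁ := (C₆* | C₆) ⊠ ({1,2} | {0,1,2}), a conditional predicate of arity 3 over {0,1,2}, and let P₁ := {001,111,120,222,212} ⊆ {0,1,2}³ and Q₁ := P₁ ∪ {000}. Then there exists a sequence 𝓘 = (I₁, I₂, I₃) of subsets of [3], each of size 2, such that R₁ | S₁ is an 𝓘-substructure of P₁ | Q₁. -/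
open Set

/-- The coordinate omitted by each of the three index sets. -/
def dropIdx : Fin 3 → Fin 2 ⊕ Fin 1 := ![Sum.inr 0, Sum.inl 1, Sum.inl 0]

/-- The map on the first two coordinates. -/
def tab0 : Fin 3 → Fin 3 → Fin 3 := ![![0, 0, 0], ![1, 0, 2], ![0, 1, 2]]

/-- The map on the first and third coordinates. -/
def tab1 : Fin 3 → Fin 3 → Fin 3 := ![![0, 0, 0], ![2, 1, 1], ![1, 1, 1]]

/-- The map on the last two coordinates. -/
def tab2 : Fin 3 → Fin 3 → Fin 3 := ![![0, 1, 1], ![1, 1, 1], ![2, 2, 2]]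

/-- The maps, as functions of a full tuple. -/
def tabs (j : Fin 3) (x : Fin 2 ⊕ Fin 1 → Fin 3) : Fin 3 :=
  ![tab0 (x (Sum.inl 0)) (x (Sum.inl 1)), tab1 (x (Sum.inl 0)) (x (Sum.inr 0)),
    tab2 (x (Sum.inl 1)) (x (Sum.inr 0))] j

theorem tabs_eq (x : Fin 2 ⊕ Fin 1 → Fin 3) :
    (fun j => tabs j (fun i => if i ≠ dropIdx j then x i else 0)) =
      ![tab0 (x (Sum.inl 0)) (x (Sum.inl 1)), tab1 (x (Sum.inl 0)) (x (Sum.inr 0)),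
        tab2 (x (Sum.inl 1)) (x (Sum.inr 0))] := by
  funext j
  fin_cases j <;> simp [tabs, dropIdx]

theorem mem_C6 (x : Fin 2 → Fin 3) : x ∈ C6 ↔
    (x 0 = 0 ∧ x 1 = 0) ∨ (x 0 = 0 ∧ x 1 = 1) ∨ (x 0 = 1 ∧ x 1 = 0) ∨
    (x 0 = 1 ∧ x 1 = 2) ∨ (x 0 = 2 ∧ x 1 = 1) ∨ (x 0 = 2 ∧ x 1 = 2) := by
  simp [C6, funext_iff, Fin.forall_fin_two]

theorem mem_C6star (x : Fin 2 → Fin 3) : x ∈ C6star ↔ x ∈ C6 ∧ ¬ (x 0 = 0 ∧ x 1 = 0) := by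
  simp [C6star, funext_iff, Fin.forall_fin_two]

theorem mem_CatP1 (a b c : Fin 3) : ![a, b, c] ∈ CatP1 ↔
    ![a, b, c] ∈ ({![0,0,1], ![1,1,1], ![1,2,0], ![2,2,2], ![2,1,2]} :
      Finset (Fin 3 → Fin 3)) := by
  simp [CatP1]

theorem key_pos : ∀ a b c : Fin 3,
    ((a = 0 ∧ b = 0) ∨ (a = 0 ∧ b = 1) ∨ (a = 1 ∧ b = 0) ∨
    (a = 1 ∧ b = 2) ∨ (a = 2 ∧ b = 1) ∨ (a = 2 ∧ b = 2)) →
    (¬ (a = 0 ∧ b = 0) ∨ c = 1 ∨ c = 2) →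
    ![tab0 a b, tab1 a c, tab2 b c] ∈
      ({![0,0,1], ![1,1,1], ![1,2,0], ![2,2,2], ![2,1,2]} : Finset (Fin 3 → Fin 3)) := by
  decide

/-- Lemma: there is a sequence `𝓘` of subsets of [3] (here: of `Fin 2 ⊕ Fin 1`),
each of size 2, such that `R₁ | S₁ = (C₆* | C₆) ⊠ ({1,2} | {0,1,2})` is an
`𝓘`-substructure of the Catalan projection `CatP1 | CatQ1`. -/
theorem R1S1_substructure_of_P1Q1 :
    ∃ 𝓘 : Fin 3 → Set (Fin 2 ⊕ Fin 1),
      (∀ j, (𝓘 j).ncard = 2) ∧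
      IsSubstructure (boxP C6star C6 U12 Set.univ) (boxQ C6 Set.univ) CatP1 CatQ1 𝓘 := by
  refine ⟨fun j => {i | i ≠ dropIdx j}, ?_, ?_⟩
  · intro j
    rw [Set.ncard_eq_toFinset_card']
    revert j
    decide
  refine ⟨fun j y => tabs j (fun i => if h : i ≠ dropIdx j then y ⟨i, h⟩ else 0), ?_, ?_⟩
  · intro x hx
    change (fun j => tabs j (fun i => if i ≠ dropIdx j then x i else 0)) ∈ CatP1
    rw [tabs_eq, mem_CatP1]
    rcases hx with ⟨h, -⟩ | ⟨h, h'⟩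
    · rw [mem_C6star, mem_C6] at h
      exact key_pos _ _ _ h.1 (Or.inl h.2)
    · rw [mem_C6] at h
      exact key_pos _ _ _ h (Or.inr h')
  · rintro x ⟨⟨hQ, -⟩, hP⟩
    change (fun j => tabs j (fun i => if i ≠ dropIdx j then x i else 0)) ∈ CatQ1 \ CatP1
    rw [tabs_eq]
    have h0 : x (Sum.inl 0) = 0 ∧ x (Sum.inl 1) = 0 := by
      by_contra h
      exact hP (Or.inl ⟨(mem_C6star _).2 ⟨hQ, h⟩, trivial⟩)
    have h1 : x (Sum.inr 0) = 0 := by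
      have h : ¬ (x (Sum.inr 0) = 1 ∨ x (Sum.inr 0) = 2) := fun h => hP (Or.inr ⟨hQ, h⟩)
      generalize x (Sum.inr 0) = c at h
      revert c
      decide
    rw [h0.1, h0.2, h1]
    refine ⟨Or.inr ?_, ?_⟩
    · simp [tab0, tab1, tab2]
    · rw [mem_CatP1]
      decide
end

section
/- Let R₁ | S₁ := (C₆* | C₆) ⊠ ({1,2} | {0,1,2}), a conditional predicate of arity 3 over {0,1,2}, and let P₂ := {011,111,120,222,202} ⊆ {0,1,2}³ and Q₂ := P₂ ∪ {000}. Then there exists a sequence 𝓘 = (I₁, I₂, I₃) of subsets of [3], each of size 2, such that R₁ | S₁ is an 𝓘-substructure of P₂ | Q₂. -/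
open Set

/-- First coordinate of each index pair. -/
def idxA : Fin 3 → Fin 2 ⊕ Fin 1 := ![Sum.inl 0, Sum.inl 1, Sum.inl 0]

/-- Second coordinate of each index pair. -/
def idxB : Fin 3 → Fin 2 ⊕ Fin 1 := ![Sum.inr 0, Sum.inr 0, Sum.inl 1]

/-- The tables of the maps `g j`. -/
def tab : Fin 3 → Fin 3 → Fin 3 → Fin 3 :=
  ![![![0,1,1], ![2,2,2], ![1,1,1]],
    ![![0,2,2], ![1,1,1], ![2,2,2]],
    ![![0,1,0], ![2,0,2], ![0,1,0]]]

lemma tab_P : ∀ a b c : Fin 3,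
    (![a,b] = (![0,0] : Fin 2 → Fin 3) ∨ ![a,b] = ![0,1] ∨ ![a,b] = ![1,0] ∨ ![a,b] = ![1,2] ∨
      ![a,b] = ![2,1] ∨ ![a,b] = ![2,2]) →
    ((![a,b] = (![0,0] : Fin 2 → Fin 3) ∧ c = 0) ∧ ![tab 0 a c, tab 1 b c, tab 2 a b] = ![0,0,0]) ∨
    (¬ (![a,b] = (![0,0] : Fin 2 → Fin 3) ∧ c = 0) ∧
      (![tab 0 a c, tab 1 b c, tab 2 a b] = ![0,1,1] ∨
       ![tab 0 a c, tab 1 b c, tab 2 a b] = ![1,1,1] ∨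
       ![tab 0 a c, tab 1 b c, tab 2 a b] = ![1,2,0] ∨
       ![tab 0 a c, tab 1 b c, tab 2 a b] = ![2,2,2] ∨
       ![tab 0 a c, tab 1 b c, tab 2 a b] = ![2,0,2])) := by
  decide

lemma zero_notMem : (![0,0,0] : Fin 3 → Fin 3) ∉ CatP2 := by
  simp only [CatP2, Set.mem_insert_iff, Set.mem_singleton_iff]
  decide

/-- Lemma: there is a sequence `𝓘` of subsets of [3] (here: of `Fin 2 ⊕ Fin 1`),
each of size 2, such that `R₁ | S₁ = (C₆* | C₆) ⊠ ({1,2} | {0,1,2})` is an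
`𝓘`-substructure of the Catalan projection `CatP2 | CatQ2`. -/
theorem R1S1_substructure_of_P2Q2 :
    ∃ 𝓘 : Fin 3 → Set (Fin 2 ⊕ Fin 1),
      (∀ j, (𝓘 j).ncard = 2) ∧
      IsSubstructure (boxP C6star C6 U12 Set.univ) (boxQ C6 Set.univ) CatP2 CatQ2 𝓘 := by
  refine ⟨fun j => {idxA j, idxB j}, ?_, fun j f =>
    tab j (f ⟨idxA j, by simp⟩) (f ⟨idxB j, by simp⟩), ?_, ?_⟩
  · intro j
    apply Set.ncard_pair
    revert j
    decide
  all_goals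
    intro x hx
    have e1 : (fun i => x (Sum.inl i)) = ![x (Sum.inl 0), x (Sum.inl 1)] := by
      funext i; fin_cases i <;> rfl
    have e2 : (fun j => tab j (x (idxA j)) (x (idxB j))) =
        ![tab 0 (x (Sum.inl 0)) (x (Sum.inr 0)), tab 1 (x (Sum.inl 1)) (x (Sum.inr 0)),
          tab 2 (x (Sum.inl 0)) (x (Sum.inl 1))] := by
      funext i; fin_cases i <;> rfl
    have key := tab_P (x (Sum.inl 0)) (x (Sum.inl 1)) (x (Sum.inr 0))
    rw [← e1, ← e2] at key
    have hC : (fun i => x (Sum.inl i)) ∈ C6 := by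
      first
        | exact hx.1.1
        | exact hx.elim (fun h => h.1.1) (fun h => h.1)
    rcases key hC with ⟨⟨h1, h2⟩, h3⟩ | ⟨h1, h3⟩
  · exfalso
    rcases hx with h | h
    · exact h.1.2 h1
    · have := h.2
      simp [U12, h2] at this
  · exact h3
  · exact ⟨Or.inr h3, fun h => zero_notMem (h3 ▸ h)⟩
  · exfalso
    apply hx.2
    by_cases h0 : (fun i => x (Sum.inl i)) = ![0,0]
    · right
      refine ⟨hC, ?_⟩
      have hc : x (Sum.inr 0) ≠ 0 := fun h => h1 ⟨h0, h⟩
      change x (Sum.inr 0) = 1 ∨ x (Sum.inr 0) = 2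
      generalize x (Sum.inr 0) = c at hc
      revert c
      decide
    · exact Or.inl ⟨⟨hC, h0⟩, trivial⟩
end
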